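/- arXiv:2407.02635 — 4 statements merged into one kernel-verified Lean document; each statement's English description precedes it below -/
import Mathlib

section
/- If k ≥ 6 is even and n > (5/4)k² + 2k (with k < n/2), then the generalized Petersen graph GP(n,k) is not 2-distance-balanced. -/
/-- The generalized Petersen graph `GP(n,k)`: vertices are `Sum.inl i` (the outer
vertices `u_i`) and `Sum.inr i` (the inner vertices `v_i`) for `i ∈ ZMod n`, with
edges `u_i u_{i+1}`, `v_i v_{i+k}` and spokes `u_i v_i`. -/
def genPetersen (n k : ℕ) : SimpleGraph (ZMod n ⊕ ZMod n) :=
  SimpleGraph.fromRel (fun x y =>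
    match x, y with
    | Sum.inl i, Sum.inl j => j = i + 1
    | Sum.inr i, Sum.inr j => j = i + (k : ZMod n)
    | Sum.inl i, Sum.inr j => i = j
    | _, _ => False)

/-- `W_{xy}`: the set of vertices strictly closer to `x` than to `y`. -/
def closerSet {V : Type*} (G : SimpleGraph V) (x y : V) : Set V :=
  {w | G.dist w x < G.dist w y}

/-- `_xW_y`: the set of vertices equidistant from `x` and `y`. -/
def eqDistSet {V : Type*} (G : SimpleGraph V) (x y : V) : Set V :=
  {w | G.dist w x = G.dist w y}

/-- A graph is `ℓ`-distance-balanced if every pair of vertices at distance `ℓ`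
is balanced. -/
def IsLDistBalanced {V : Type*} (G : SimpleGraph V) (ℓ : ℕ) : Prop :=
  ∀ x y : V, G.dist x y = ℓ → (closerSet G x y).ncard = (closerSet G y x).ncard

/-- A graph is distance-balanced if every pair of adjacent vertices is balanced. -/
def IsDistBalanced {V : Type*} (G : SimpleGraph V) : Prop :=
  ∀ x y : V, G.Adj x y → (closerSet G x y).ncard = (closerSet G y x).ncard

namespace GPaux

/-- sign -/
def sg (z : ℤ) : ℤ := if 0 < z then 1 else if z < 0 then -1 else 0

lemma adj_uu {n k : ℕ} (i j : ZMod n) :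
    (genPetersen n k).Adj (Sum.inl i) (Sum.inl j) ↔ i ≠ j ∧ (j = i + 1 ∨ i = j + 1) := by
  simp [genPetersen, SimpleGraph.fromRel_adj]

lemma adj_vv {n k : ℕ} (i j : ZMod n) :
    (genPetersen n k).Adj (Sum.inr i) (Sum.inr j) ↔ i ≠ j ∧ (j = i + k ∨ i = j + k) := by
  simp [genPetersen, SimpleGraph.fromRel_adj]

lemma adj_uv {n k : ℕ} (i j : ZMod n) :
    (genPetersen n k).Adj (Sum.inl i) (Sum.inr j) ↔ i = j := by
  simp [genPetersen, SimpleGraph.fromRel_adj]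

/-- walk of length at most m -/
def R {V : Type*} (G : SimpleGraph V) (x y : V) (m : ℕ) : Prop := ∃ p : G.Walk x y, p.length ≤ m

lemma R.trans {V : Type*} {G : SimpleGraph V} {x y z : V} {m l : ℕ}
    (h : R G x y m) (h' : R G y z l) : R G x z (m + l) := by
  obtain ⟨p, hp⟩ := h
  obtain ⟨q, hq⟩ := h'
  exact ⟨p.append q, by rw [SimpleGraph.Walk.length_append]; omega⟩

lemma R.symm {V : Type*} {G : SimpleGraph V} {x y : V} {m : ℕ}
    (h : R G x y m) : R G y x m := by
  obtain ⟨p, hp⟩ := h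
  exact ⟨p.reverse, by rw [SimpleGraph.Walk.length_reverse]; omega⟩

lemma R.le {V : Type*} {G : SimpleGraph V} {x y : V} {m : ℕ}
    (h : R G x y m) : G.dist x y ≤ m := by
  obtain ⟨p, hp⟩ := h
  exact (SimpleGraph.dist_le p).trans hp

lemma R_of_adj {V : Type*} {G : SimpleGraph V} {x y : V} (h : G.Adj x y) : R G x y 1 :=
  ⟨h.toWalk, by simp⟩

/-- A step function gives lines. -/
lemma R_line {V : Type*} {n : ℕ} {G : SimpleGraph V} (f : ZMod n → V) (c : ZMod n)
    (hf : ∀ i, R G (f i) (f (i + c)) 1) (i : ZMod n) (x : ℤ) :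
    R G (f i) (f (i + x * c)) x.natAbs := by
  have key : ∀ (m : ℕ) (i : ZMod n), R G (f i) (f (i + m * c)) m := by
    intro m
    induction m with
    | zero => 
      intro i
      have h0 : R G (f i) (f i) 0 := ⟨SimpleGraph.Walk.nil, by simp⟩
      simp only [Nat.cast_zero, zero_mul, add_zero]
      exact h0
    | succ m ih =>
      intro i
      have := (ih i).trans (hf _)
      have e : i + ((m + 1 : ℕ) : ZMod n) * c = i + m * c + c := by push_cast; ring
      rw [e]; exact this
  obtain ⟨m, rfl | rfl⟩ := x.eq_nat_or_neg
  · simpa using key m i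
  · have := (key m (i + ((-(m : ℤ) : ℤ) : ZMod n) * c)).symm
    have e : i + ((-(m : ℤ) : ℤ) : ZMod n) * c + m * c = i := by push_cast; ring
    rw [e] at this
    simpa using this

/-- representability -/
def P (n k : ℕ) (j : ZMod n) (m : ℕ) : Prop :=
  ∃ x y : ℤ, ((x + y * k : ℤ) : ZMod n) = j ∧ x.natAbs + y.natAbs = m

/-- distance in the circulant graph -/
noncomputable def a (n k : ℕ) (j : ZMod n) : ℕ := sInf {m | P n k j m}

lemma a_le {n k : ℕ} (x y : ℤ) (j : ZMod n) (h : ((x + y * k : ℤ) : ZMod n) = j) :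
    a n k j ≤ x.natAbs + y.natAbs := Nat.sInf_le ⟨x, y, h, rfl⟩

lemma a_spec {n k : ℕ} (j : ZMod n) :
    ∃ x y : ℤ, ((x + y * k : ℤ) : ZMod n) = j ∧ x.natAbs + y.natAbs = a n k j := by
  have : {m | P n k j m}.Nonempty := by
    obtain ⟨t, rfl⟩ := ZMod.intCast_surjective j
    exact ⟨_, t, 0, by simp, rfl⟩
  exact Nat.sInf_mem this

lemma a_lift {n k : ℕ} (t : ℤ) :
    ∃ x y c : ℤ, x + y * k = t + n * c ∧ x.natAbs + y.natAbs = a n k (t : ZMod n) := by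
  obtain ⟨x, y, h, h'⟩ := a_spec (n := n) (k := k) (t : ZMod n)
  rw [ZMod.intCast_eq_intCast_iff_dvd_sub] at h
  obtain ⟨c, hc⟩ := h
  exact ⟨x, y, -c, by linarith, h'⟩

lemma a_step {n k : ℕ} (j : ZMod n) (x y : ℤ) :
    a n k (j + ((x + y * k : ℤ) : ZMod n)) ≤ a n k j + x.natAbs + y.natAbs := by
  obtain ⟨x', y', h, h'⟩ := a_spec (n := n) (k := k) j
  have := a_le (n := n) (k := k) (x' + x) (y' + y) (j + ((x + y * k : ℤ) : ZMod n))
    (by rw [← h]; push_cast; ring)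
  omega

lemma a_add_one {n k : ℕ} (j : ZMod n) : a n k (j + 1) ≤ a n k j + 1 := by
  simpa using a_step (n := n) (k := k) j 1 0
lemma a_sub_one {n k : ℕ} (j : ZMod n) : a n k j ≤ a n k (j + 1) + 1 := by
  simpa using a_step (n := n) (k := k) (j + 1) (-1) 0
lemma a_add_k {n k : ℕ} (j : ZMod n) : a n k (j + k) ≤ a n k j + 1 := by
  simpa using a_step (n := n) (k := k) j 0 1
lemma a_sub_k {n k : ℕ} (j : ZMod n) : a n k j ≤ a n k (j + k) + 1 := by
  simpa using a_step (n := n) (k := k) (j + k) 0 (-1)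

/-- cyclic absolute value -/
def N {n : ℕ} (j : ZMod n) : ℕ := j.valMinAbs.natAbs

lemma N_add_one {n : ℕ} [NeZero n] (hn : 2 < n) (j : ZMod n) :
    N (j + 1) ≤ N j + 1 ∧ N j ≤ N (j + 1) + 1 := by
  have h1 : N (1 : ZMod n) ≤ 1 := by
    have := ZMod.natAbs_valMinAbs_le (1 : ZMod n)
    have h2 := ZMod.valMinAbs_natCast_of_le_half (n := n) (a := 1) (by omega)
    unfold N
    simp at h2
    rw [h2]; simp
  have h1' : N (-1 : ZMod n) ≤ 1 := by
    unfold N at *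
    rw [ZMod.natAbs_valMinAbs_neg]; exact h1
  constructor
  · have := ZMod.natAbs_valMinAbs_add_le j 1
    unfold N at *
    have h3 := Int.natAbs_add_le j.valMinAbs (1 : ZMod n).valMinAbs
    omega
  · have := ZMod.natAbs_valMinAbs_add_le (j + 1) (-1)
    unfold N at *
    have h3 := Int.natAbs_add_le (j + 1).valMinAbs (-1 : ZMod n).valMinAbs
    rw [add_neg_cancel_right] at this
    omega

lemma a_le_N {n k : ℕ} (j : ZMod n) : a n k j ≤ N j := by
  have := a_le (n := n) (k := k) j.valMinAbs 0 j (by simp)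
  simpa [N] using this

/-- potential -/
noncomputable def F (n k : ℕ) : ZMod n ⊕ ZMod n → ℕ
  | Sum.inl j => min (N j) (a n k j + 2)
  | Sum.inr j => a n k j + 1

lemma F_adj {n k : ℕ} [NeZero n] (hn : 2 < n) (x y : ZMod n ⊕ ZMod n)
    (h : (genPetersen n k).Adj x y) : F n k x ≤ F n k y + 1 := by
  rcases x with i | i <;> rcases y with j | j
  · rw [adj_uu] at h
    rcases h.2 with rfl | rfl
    · have := N_add_one hn i
      have := a_add_one (n := n) (k := k) i
      have := a_sub_one (n := n) (k := k) i
      simp only [F]; omega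
    · have := N_add_one hn j
      have := a_add_one (n := n) (k := k) j
      have := a_sub_one (n := n) (k := k) j
      simp only [F]; omega
  · rw [adj_uv] at h
    subst h
    simp only [F]; omega
  · have h := h.symm
    rw [adj_uv] at h
    subst h
    have := a_le_N (n := n) (k := k) j
    simp only [F]; omega
  · rw [adj_vv] at h
    rcases h.2 with rfl | rfl
    · have := a_add_k (n := n) (k := k) i
      have := a_sub_k (n := n) (k := k) i
      simp only [F]; omega
    · have := a_add_k (n := n) (k := k) j
      have := a_sub_k (n := n) (k := k) j
      simp only [F]; omega

lemma F_walk {n k : ℕ} [NeZero n] (hn : 2 < n) {x y : ZMod n ⊕ ZMod n}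
    (p : (genPetersen n k).Walk x y) : F n k x ≤ F n k y + p.length := by
  induction p with
  | nil => simp
  | cons h p ih =>
    have := F_adj hn _ _ h
    rw [SimpleGraph.Walk.length_cons]; omega

lemma k_ne {n k : ℕ} (hk : 0 < k) (hkn : 2 * k < n) : (k : ZMod n) ≠ 0 := by
  intro h
  rw [ZMod.natCast_eq_zero_iff] at h
  have := Nat.le_of_dvd hk h
  omega

lemma R_u {n k : ℕ} (hn : 2 < n) (i : ZMod n) (x : ℤ) :
    R (genPetersen n k) (Sum.inl i) (Sum.inl (i + x)) x.natAbs := by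
  have : Fact (1 < n) := ⟨by omega⟩
  have := R_line (G := genPetersen n k) (fun i : ZMod n => Sum.inl i) 1
    (fun i => R_of_adj ((adj_uu _ _).2 ⟨by simp, Or.inl rfl⟩)) i x
  simpa using this

lemma R_v {n k : ℕ} (hk : 0 < k) (hkn : 2 * k < n) (i : ZMod n) (x : ℤ) :
    R (genPetersen n k) (Sum.inr i) (Sum.inr (i + x * k)) x.natAbs :=
  R_line (G := genPetersen n k) (fun i : ZMod n => Sum.inr i) k
    (fun i => R_of_adj ((adj_vv _ _).2 ⟨by simpa using k_ne hk hkn, Or.inl rfl⟩)) i x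

lemma R_uv {n k : ℕ} (hk : 0 < k) (hkn : 2 * k < n) (hn : 2 < n) (i j : ZMod n) :
    R (genPetersen n k) (Sum.inl i) (Sum.inr j) (a n k (j - i) + 1) := by
  obtain ⟨x, y, h, h'⟩ := a_spec (n := n) (k := k) (j - i)
  have h1 := R_u (k := k) hn i x
  have h2 : R (genPetersen n k) (Sum.inl (i + x)) (Sum.inr (i + x)) 1 :=
    R_of_adj ((adj_uv _ _).2 rfl)
  have h3 := R_v hk hkn (i + x) y
  have e : i + x + y * k = j := by
    have : (j : ZMod n) = i + (j - i) := by ring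
    rw [this, ← h]; push_cast; ring
  rw [e] at h3
  have := (h1.trans h2).trans h3
  rw [← h']
  convert this using 1; omega

lemma R_vv {n k : ℕ} (hk : 0 < k) (hkn : 2 * k < n) (hn : 2 < n) (i j : ZMod n) :
    R (genPetersen n k) (Sum.inr i) (Sum.inr j) (a n k (j - i) + 2) := by
  have h2 : R (genPetersen n k) (Sum.inl i) (Sum.inr i) 1 :=
    R_of_adj ((adj_uv _ _).2 rfl)
  have := h2.symm.trans (R_uv hk hkn hn i j)
  convert this using 1; omega

lemma F_le_dist {n k : ℕ} [NeZero n] (hk : 0 < k) (hkn : 2 * k < n) (hn : 2 < n)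
    (w : ZMod n ⊕ ZMod n) : F n k w ≤ (genPetersen n k).dist w (Sum.inl 0) := by
  have hr : (genPetersen n k).Reachable w (Sum.inl 0) := by
    rcases w with j | j
    · obtain ⟨p, _⟩ := (R_uv hk hkn hn j 0).trans (R_uv hk hkn hn 0 0).symm
      exact ⟨p⟩
    · obtain ⟨p, _⟩ := (R_uv hk hkn hn 0 j).symm
      exact ⟨p⟩
  obtain ⟨p, hp⟩ := hr.exists_walk_length_eq_dist
  have := F_walk hn p
  have h0 : F n k (Sum.inl 0) = 0 := by simp [F, N]
  omega

/-- lift without wrap-around -/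
lemma a_lift' {n k m : ℕ} (hk : 0 < k) (t : ℤ) (hm : a n k (t : ZMod n) ≤ m)
    (ht : |t| + (m : ℤ) * k < n) :
    ∃ x y : ℤ, x + y * k = t ∧ x.natAbs + y.natAbs ≤ m := by
  obtain ⟨x, y, c, h, h'⟩ := a_lift (n := n) (k := k) t
  have hb : |x + y * k| ≤ (m : ℤ) * k := by
    have h1 := abs_add_le x (y * k)
    have h2 : |y * k| = |y| * (k : ℤ) := by rw [abs_mul, Nat.abs_cast]
    have h3 : |x| ≤ |x| * (k : ℤ) := by
      have : (1 : ℤ) ≤ k := by omega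
      nlinarith [abs_nonneg x]
    have h4 : |x| + |y| ≤ (m : ℤ) := by rw [Int.abs_eq_natAbs, Int.abs_eq_natAbs]; omega
    nlinarith
  have hc : c = 0 := by
    by_contra hc
    rw [h] at hb
    have h5 : |(n : ℤ) * c| ≤ |t + n * c| + |t| := by
      have := abs_sub (t + n * c) t
      simpa using this
    have h6 : (n : ℤ) ≤ |(n : ℤ) * c| := by
      rw [abs_mul, Nat.abs_cast]
      have : 1 ≤ |c| := Int.one_le_abs hc
      nlinarith
    linarith
  subst hc
  exact ⟨x, y, by simpa using h, by omega⟩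

lemma sg_le (z : ℤ) : sg z ≤ 1 ∧ -1 ≤ sg z := by
  unfold sg; split_ifs <;> omega

lemma sg_mono {x y : ℤ} (h : x ≤ y) : sg x ≤ sg y := by
  unfold sg; split_ifs <;> omega

lemma not_a_le_pos {n h : ℕ} (hh : 3 ≤ h) (hn : 5 * h ^ 2 + 4 * h < n) (t : ℤ) (h0 : 0 ≤ t)
    (h1 : t < h) : t < a n (2 * h) (((2 * h : ℕ) : ZMod n) - t) := by
  by_contra hc
  push Not at hc
  obtain ⟨t, rfl⟩ := Int.eq_ofNat_of_zero_le h0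
  have e : (((2 * h : ℕ) : ZMod n) - ((t : ℤ) : ZMod n)) = ((2 * h - t : ℤ) : ZMod n) := by
    push_cast; ring
  rw [e] at hc
  obtain ⟨x, y, hxy, hle⟩ := a_lift' (n := n) (k := 2 * h) (m := t) (by omega) (2 * h - t)
    (by exact_mod_cast hc) (by
      rw [abs_of_nonneg (by omega)]; push_cast; zify at hn
      nlinarith)
  push_cast at hxy
  have hy : y ≤ -1 ∨ y = 0 ∨ y = 1 ∨ 2 ≤ y := by omega
  rcases hy with hy | rfl | rfl | hy
  · have : y * (2 * h) ≤ -1 * (2 * (h : ℤ)) := mul_le_mul_of_nonneg_right hy (by positivity)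
    omega
  · omega
  · omega
  · have : 2 * (2 * (h : ℤ)) ≤ y * (2 * h) := mul_le_mul_of_nonneg_right hy (by positivity)
    omega

lemma not_a_le_neg {n h : ℕ} (hh : 3 ≤ h) (hn : 5 * h ^ 2 + 4 * h < n) (t : ℤ) (h0 : t ≤ 0)
    (h1 : -h ≤ t) : -t < a n (2 * h) (((2 * h : ℕ) : ZMod n) - t) := by
  by_contra hc
  push Not at hc
  obtain ⟨t, rfl⟩ := Int.exists_eq_neg_ofNat h0
  have e : (((2 * h : ℕ) : ZMod n) - ((-t : ℤ) : ZMod n)) = ((2 * h + t : ℤ) : ZMod n) := by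
    push_cast; ring
  rw [e, neg_neg] at hc
  obtain ⟨x, y, hxy, hle⟩ := a_lift' (n := n) (k := 2 * h) (m := t) (by omega) (2 * h + t)
    (by exact_mod_cast hc) (by
      rw [abs_of_nonneg (by omega)]; push_cast; zify at hn
      nlinarith)
  push_cast at hxy
  have hy : y ≤ -1 ∨ y = 0 ∨ y = 1 ∨ y = 2 ∨ 3 ≤ y := by omega
  rcases hy with hy | rfl | rfl | rfl | hy
  · have : y * (2 * h) ≤ -1 * (2 * (h : ℤ)) := mul_le_mul_of_nonneg_right hy (by positivity)
    omega
  · omega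
  · omega
  · omega
  · have : 3 * (2 * (h : ℤ)) ≤ y * (2 * h) := mul_le_mul_of_nonneg_right hy (by positivity)
    omega

/-- indices where the outer vertex loses -/
noncomputable def lossSet (n h : ℕ) : Finset (ZMod n) :=
  (Finset.Icc (-(h : ℤ) - 1) h).image (fun t : ℤ => (t : ZMod n))

/-- indices where the inner vertex gains -/
noncomputable def gainSet (n h : ℕ) : Finset (ZMod n) :=
  (Finset.Icc (-(h : ℤ) - 1) (h + 2)).image (fun b : ℤ => (((b + 1) * (2 * h) : ℤ) : ZMod n))

/-- the loss -/
noncomputable def loss (n h : ℕ) (j : ZMod n) : ℤ :=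
  (if j ∈ lossSet n h then 1 else 0) + (if j = (h : ZMod n) then 1 else 0)

lemma loss_bound {n h : ℕ} (hh : 3 ≤ h) (hn : 5 * h ^ 2 + 4 * h < n) (j : ZMod n) :
    sg (a n (2 * h) j + 1 - a n (2 * h) (((2 * h : ℕ) : ZMod n) - j)) - loss n h j ≤
    sg ((min (N j) (a n (2 * h) j + 2) : ℕ) - (a n (2 * h) (((2 * h : ℕ) : ZMod n) - j) + 1)) := by
  obtain ⟨t, ht⟩ : ∃ t, t = j.valMinAbs := ⟨_, rfl⟩
  have hN : N j = t.natAbs := by rw [ht]; rfl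
  have hj : j = (t : ZMod n) := by rw [ht]; simp
  have hlpos : 0 ≤ loss n h j := by unfold loss; split_ifs <;> omega
  have hmem : -(h : ℤ) - 1 ≤ t → t ≤ h → 1 ≤ loss n h j := by
    intro h1 h2
    have : j ∈ lossSet n h := Finset.mem_image.2 ⟨t, Finset.mem_Icc.2 ⟨h1, h2⟩, hj.symm⟩
    unfold loss; rw [if_pos this]; split_ifs <;> omega
  have hmem2 : t = h → 2 ≤ loss n h j := by
    intro h1
    have : j ∈ lossSet n h :=
      Finset.mem_image.2 ⟨t, Finset.mem_Icc.2 ⟨by omega, by omega⟩, hj.symm⟩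
    have h2 : j = (h : ZMod n) := by rw [hj, h1]; simp
    unfold loss; rw [if_pos this, if_pos h2]; omega
  have ha0 := a_le_N (k := 2 * h) j
  have ha1 := a_le (n := n) (k := 2 * h) (t - 2 * h) 1 j (by rw [hj]; push_cast; ring)
  have ha2 := a_le (n := n) (k := 2 * h) (t + 2 * h) (-1) j (by rw [hj]; push_cast; ring)
  have ha3 := a_le (n := n) (k := 2 * h) (2 * h - t) 0 (((2 * h : ℕ) : ZMod n) - j)
    (by rw [hj]; push_cast; ring)
  have hp : 0 ≤ t → t < h → t < a n (2 * h) (((2 * h : ℕ) : ZMod n) - j) := by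
    rw [hj]; exact not_a_le_pos hh hn t
  have hm : t ≤ 0 → -h ≤ t → -t < a n (2 * h) (((2 * h : ℕ) : ZMod n) - j) := by
    rw [hj]; exact not_a_le_neg hh hn t
  generalize a n (2 * h) (((2 * h : ℕ) : ZMod n) - j) = A at *
  generalize a n (2 * h) j = B at *
  generalize loss n h j = L at *
  rw [hN] at *
  clear hN hj ht
  by_cases c1 : h + 2 ≤ t.natAbs
  · have : min t.natAbs (B + 2) = B + 2 := by omega
    rw [this]
    have : ((B + 2 : ℕ) : ℤ) - (A + 1) = B + 1 - A := by push_cast; ring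
    rw [this]; omega
  by_cases c2 : t = h + 1
  · unfold sg; split_ifs <;> omega
  by_cases c3 : t = h
  · have := hmem2 c3
    unfold sg; split_ifs <;> omega
  have hL := hmem (by omega) (by omega)
  unfold sg; split_ifs <;> omega

lemma a_mul {n h : ℕ} (hh : 3 ≤ h) (hn : 5 * h ^ 2 + 4 * h < n) (b : ℤ)
    (hb : b.natAbs ≤ h + 2) : b.natAbs ≤ a n (2 * h) ((b * (2 * h) : ℤ) : ZMod n) := by
  by_contra hc
  push Not at hc
  obtain ⟨m, hm⟩ : ∃ m, b.natAbs = m + 1 := ⟨b.natAbs - 1, by omega⟩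
  have hbm : |b * (2 * h)| = ((m : ℤ) + 1) * (2 * h) := by
    rw [abs_mul, Int.abs_eq_natAbs b, hm, abs_of_nonneg (by positivity)]; push_cast; ring
  obtain ⟨x, y, hxy, hle⟩ := a_lift' (n := n) (k := 2 * h) (m := m) (by omega) (b * (2 * h))
    (by omega) (by
      rw [hbm]; push_cast; zify at hn
      have : (m : ℤ) ≤ h + 1 := by omega
      nlinarith)
  have h1 : |x + y * (2 * h)| ≤ m * (2 * (h : ℤ)) := by
    have h1 := abs_add_le x (y * (2 * h))
    have h2 : |y * (2 * h)| = |y| * (2 * h : ℤ) := by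
      rw [abs_mul, abs_of_nonneg (a := (2 * h : ℤ)) (by positivity)]
    have h3 : |x| ≤ |x| * (2 * h : ℤ) := by
      have : (1 : ℤ) ≤ 2 * h := by omega
      nlinarith [abs_nonneg x]
    have h4 : |x| + |y| ≤ (m : ℤ) := by rw [Int.abs_eq_natAbs, Int.abs_eq_natAbs]; omega
    nlinarith
  push_cast at hxy
  rw [hxy, hbm] at h1
  nlinarith

lemma card_gain {n h : ℕ} (hh : 3 ≤ h) (hn : 5 * h ^ 2 + 4 * h < n) :
    (gainSet n h).card = 2 * h + 4 := by
  unfold gainSet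
  rw [Finset.card_image_of_injOn]
  · rw [Int.card_Icc]; omega
  · intro b hb c hc hbc
    simp only [Finset.coe_Icc, Set.mem_Icc] at hb hc
    simp only [ZMod.intCast_eq_intCast_iff_dvd_sub] at hbc
    have e : (c + 1) * (2 * (h : ℤ)) - (b + 1) * (2 * h) = (c - b) * (2 * h) := by ring
    rw [e] at hbc
    have h0 := Int.eq_zero_of_abs_lt_dvd hbc (by
      rw [abs_mul, abs_of_nonneg (a := (2 * h : ℤ)) (by positivity)]
      have : |c - b| ≤ 2 * h + 3 := abs_le.2 ⟨by omega, by omega⟩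
      have h2 : |c - b| * (2 * h) ≤ (2 * h + 3) * (2 * (h : ℤ)) :=
        mul_le_mul_of_nonneg_right this (by positivity)
      zify at hn
      nlinarith)
    rcases mul_eq_zero.1 h0 with h1 | h1 <;> omega

lemma card_loss (n h : ℕ) : (lossSet n h).card ≤ 2 * h + 2 := by
  unfold lossSet
  refine Finset.card_image_le.trans ?_
  rw [Int.card_Icc]; omega

lemma sum_sg {V : Type*} [Fintype V] (G : SimpleGraph V) (x y : V)
    (h : (closerSet G x y).ncard = (closerSet G y x).ncard) :
    ∑ w, sg ((G.dist w x : ℤ) - G.dist w y) = 0 := by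
  classical
  have e : ∀ w, sg ((G.dist w x : ℤ) - G.dist w y) =
      (if G.dist w y < G.dist w x then 1 else 0) - (if G.dist w x < G.dist w y then 1 else 0) := by
    intro w
    unfold sg; split_ifs <;> omega
  have c : ∀ x y, (closerSet G x y).ncard =
      (Finset.univ.filter (fun w => G.dist w x < G.dist w y)).card := by
    intro x y
    rw [← Set.ncard_coe_finset]; congr 1; ext w; simp [closerSet]
  rw [c, c] at h
  simp only [e, Finset.sum_sub_distrib, Finset.sum_boole]
  rw [h]; simp

lemma main {n h : ℕ} (hh : 3 ≤ h) (hn : 5 * h ^ 2 + 4 * h < n) :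
    ¬ IsLDistBalanced (genPetersen n (2 * h)) 2 := by
  intro H
  have hkn : 2 * (2 * h) < n := by nlinarith
  have hk : 0 < 2 * h := by omega
  have hn2 : 2 < n := by omega
  have : NeZero n := ⟨by omega⟩
  have hd : (genPetersen n (2 * h)).dist (Sum.inl 0) (Sum.inr ((2 * h : ℕ) : ZMod n)) = 2 := by
    apply le_antisymm
    · have h1 : R (genPetersen n (2 * h)) (Sum.inl 0) (Sum.inr 0) 1 :=
        R_of_adj ((adj_uv _ _).2 rfl)
      have h2 := R_v hk hkn (0 : ZMod n) 1
      have := (h1.trans h2).le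
      simpa using this
    · rw [SimpleGraph.dist_comm]
      have h1 := F_le_dist hk hkn hn2 (Sum.inr ((2 * h : ℕ) : ZMod n))
      have h2 := a_mul hh hn 1 (by simp)
      have e : (((1 : ℤ) * (2 * h) : ℤ) : ZMod n) = ((2 * h : ℕ) : ZMod n) := by push_cast; ring
      rw [e] at h2
      simp only [F] at h1
      simp only [Int.natAbs_one] at h2
      omega
  have hs := sum_sg _ _ _ (H _ _ hd)
  rw [Fintype.sum_sum_type] at hs
  set K : ZMod n := ((2 * h : ℕ) : ZMod n) with hK
  have hu : ∑ j : ZMod n, (sg (a n (2 * h) j + 1 - a n (2 * h) (K - j)) - loss n h j) ≤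
      ∑ j : ZMod n, sg (((genPetersen n (2 * h)).dist (Sum.inl j) (Sum.inl 0) : ℤ) -
        (genPetersen n (2 * h)).dist (Sum.inl j) (Sum.inr K)) := by
    refine Finset.sum_le_sum fun j _ => (loss_bound hh hn j).trans (sg_mono ?_)
    have h1 := F_le_dist hk hkn hn2 (Sum.inl j)
    have h2 := (R_uv hk hkn hn2 j K).le
    simp only [F] at h1
    rw [← hK]
    omega
  have hv : ∑ j : ZMod n, (sg (a n (2 * h) j - (a n (2 * h) (K - j) + 1)) +
        (if j ∈ gainSet n h then 1 else 0)) ≤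
      ∑ j : ZMod n, sg (((genPetersen n (2 * h)).dist (Sum.inr j) (Sum.inl 0) : ℤ) -
        (genPetersen n (2 * h)).dist (Sum.inr j) (Sum.inr K)) := by
    refine Finset.sum_le_sum fun j _ => ?_
    have h1 := F_le_dist hk hkn hn2 (Sum.inr j)
    have h2 := (R_vv hk hkn hn2 j K).le
    simp only [F] at h1
    split_ifs with hj
    · obtain ⟨b, hb, hbj⟩ := Finset.mem_image.1 hj
      rw [Finset.mem_Icc] at hb
      have h3 := a_mul hh hn (-b) (by omega)
      have e1 : ((-b * (2 * h) : ℤ) : ZMod n) = K - j := by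
        rw [← hbj, hK]; push_cast; ring
      rw [e1] at h3
      have h4 := (R_v hk hkn j (-b)).le
      have e2 : j + ((-b : ℤ) : ZMod n) * ((2 * h : ℕ) : ZMod n) = K := by
        rw [← hbj, hK]; push_cast; ring
      rw [e2] at h4
      have h5 := a_le (n := n) (k := 2 * h) 0 (-b) (K - j) (by rw [← e1]; push_cast; ring)
      have h6 := a_le (n := n) (k := 2 * h) 0 (b + 1) j (by rw [← hbj]; push_cast; ring)
      have h7 : a n (2 * h) (K - j) ≤ a n (2 * h) j + 1 := by
        have h8 := a_sub_k (n := n) (k := 2 * h) (((b * (2 * h) : ℤ)) : ZMod n)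
        have h9 := a_mul hh hn b (by omega)
        have e3 : ((b * (2 * h) : ℤ) : ZMod n) + ((2 * h : ℕ) : ZMod n) = j := by
          rw [← hbj]; push_cast; ring
        rw [e3] at h8
        omega
      unfold sg; split_ifs <;> omega
    · rw [add_zero]
      exact sg_mono (by omega)
  rw [Finset.sum_sub_distrib] at hu
  rw [Finset.sum_add_distrib] at hv
  have hpq : ∑ j : ZMod n, sg (a n (2 * h) j + 1 - a n (2 * h) (K - j)) =
      - ∑ j : ZMod n, sg (a n (2 * h) j - (a n (2 * h) (K - j) + 1)) := by
    rw [← Equiv.sum_comp (Equiv.subLeft K)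
      (fun j => sg ((a n (2 * h) j : ℤ) - (a n (2 * h) (K - j) + 1))), ← Finset.sum_neg_distrib]
    refine Finset.sum_congr rfl fun j _ => ?_
    simp only [Equiv.subLeft_apply, sub_sub_cancel]
    unfold sg; split_ifs <;> omega
  have hg : ∑ j : ZMod n, (if j ∈ gainSet n h then (1 : ℤ) else 0) = 2 * h + 4 := by
    rw [Finset.sum_boole]
    simp [card_gain hh hn]
  have hl : ∑ j : ZMod n, loss n h j ≤ 2 * h + 3 := by
    unfold loss
    rw [Finset.sum_add_distrib, Finset.sum_boole]
    have := card_loss n h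
    simp
    omega
  linarith

end GPaux

theorem stmt_6 (n k : ℕ) (hk : 6 ≤ k) (hke : Even k)
    (hn : 5 * k ^ 2 + 8 * k < 4 * n) (hkn : 2 * k < n) :
    ¬ IsLDistBalanced (genPetersen n k) 2 := by
  obtain ⟨h, rfl⟩ := hke
  have e : h + h = 2 * h := by ring
  rw [e] at *
  exact GPaux.main (by omega) (by nlinarith)
end

section
/- If k ≥ 5 is odd and n > (7/4)k² + (3/4)k (with k < n/2), then the generalized Petersen graph GP(n,k) is not 2-distance-balanced. -/
lemma gp_adj_outer (n k : ℕ) (hn : 2 < n) (i : ZMod n) :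
    (genPetersen n k).Adj (Sum.inl i) (Sum.inl (i + 1)) := by
  have : Fact (1 < n) := ⟨by omega⟩
  rw [genPetersen, SimpleGraph.fromRel_adj]
  refine ⟨?_, Or.inl rfl⟩
  intro h
  have := Sum.inl.inj h
  simp at this

lemma gp_adj_spoke (n k : ℕ) (i : ZMod n) :
    (genPetersen n k).Adj (Sum.inl i) (Sum.inr i) := by
  rw [genPetersen, SimpleGraph.fromRel_adj]
  exact ⟨by simp, Or.inl rfl⟩

lemma gp_adj_inner (n k : ℕ) (hk : 0 < k) (hkn : k < n) (i : ZMod n) :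
    (genPetersen n k).Adj (Sum.inr i) (Sum.inr (i + k)) := by
  rw [genPetersen, SimpleGraph.fromRel_adj]
  refine ⟨?_, Or.inl rfl⟩
  intro h
  have h1 := Sum.inr.inj h
  have h2 : ((k : ℕ) : ZMod n) = 0 := by simpa using h1
  rw [ZMod.natCast_eq_zero_iff] at h2
  exact absurd (Nat.le_of_dvd hk h2) (by omega)

/-- The index of a vertex. -/
def gpIdx {n : ℕ} : ZMod n ⊕ ZMod n → ZMod n
  | Sum.inl i => i
  | Sum.inr i => i

/-- The cost of a path making `a` net outer steps and `b` net inner steps. -/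
def gpCost {n : ℕ} : ZMod n ⊕ ZMod n → ZMod n ⊕ ZMod n → ℤ → ℤ → ℤ
  | Sum.inl _, Sum.inl _, a, b => |a| + |b| + (if b = 0 then 0 else 2)
  | Sum.inr _, Sum.inr _, a, b => |a| + |b| + (if a = 0 then 0 else 2)
  | _, _, a, b => |a| + |b| + 1

lemma gp_walk_lower (n k : ℕ) {x y : ZMod n ⊕ ZMod n} (p : (genPetersen n k).Walk x y) :
    ∃ a b : ℤ, gpIdx y - gpIdx x = (a : ZMod n) + k * (b : ZMod n) ∧
      gpCost x y a b ≤ p.length := by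
  induction p with
  | nil =>
    rename_i u
    exact ⟨0, 0, by simp, by cases u <;> simp [gpCost]⟩
  | cons h p ih =>
    rename_i u v w
    obtain ⟨a, b, hab, hc⟩ := ih
    rw [genPetersen, SimpleGraph.fromRel_adj] at h
    obtain ⟨-, h⟩ := h
    rw [SimpleGraph.Walk.length_cons]
    push_cast
    rcases u with i | i <;> rcases v with i' | i' <;> simp only [or_false, false_or] at h
    · rcases h with h | h
      · refine ⟨a + 1, b, ?_, ?_⟩
        · subst h; simp only [gpIdx] at hab ⊢; push_cast; linear_combination hab
        · rcases w with w | w <;> simp only [gpCost] at hc ⊢ <;> grind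
      · refine ⟨a - 1, b, ?_, ?_⟩
        · subst h; simp only [gpIdx] at hab ⊢; push_cast; linear_combination hab
        · rcases w with w | w <;> simp only [gpCost] at hc ⊢ <;> grind
    · refine ⟨a, b, ?_, ?_⟩
      · subst h; simpa only [gpIdx] using hab
      · rcases w with w | w <;> simp only [gpCost] at hc ⊢ <;> grind
    · refine ⟨a, b, ?_, ?_⟩
      · subst h; simpa only [gpIdx] using hab
      · rcases w with w | w <;> simp only [gpCost] at hc ⊢ <;> grind
    · rcases h with h | h
      · refine ⟨a, b + 1, ?_, ?_⟩
        · subst h; simp only [gpIdx] at hab ⊢; push_cast; linear_combination hab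
        · rcases w with w | w <;> simp only [gpCost] at hc ⊢ <;> grind
      · refine ⟨a, b - 1, ?_, ?_⟩
        · subst h; simp only [gpIdx] at hab ⊢; push_cast; linear_combination hab
        · rcases w with w | w <;> simp only [gpCost] at hc ⊢ <;> grind

lemma gp_walk_outer_nat (n k : ℕ) (hn : 2 < n) (a : ℕ) (i : ZMod n) :
    ∃ p : (genPetersen n k).Walk (Sum.inl i) (Sum.inl (i + a)), p.length = a := by
  induction a with
  | zero => exact ⟨SimpleGraph.Walk.nil.copy rfl (by simp), by simp⟩
  | succ a ih =>
    obtain ⟨p, hp⟩ := ih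
    refine ⟨(p.concat (gp_adj_outer n k hn _)).copy rfl (by push_cast; rw [add_assoc]), by simp [hp]⟩

lemma gp_walk_inner_nat (n k : ℕ) (hk : 0 < k) (hkn : k < n) (a : ℕ) (i : ZMod n) :
    ∃ p : (genPetersen n k).Walk (Sum.inr i) (Sum.inr (i + k * a)), p.length = a := by
  induction a with
  | zero => exact ⟨SimpleGraph.Walk.nil.copy rfl (by simp), by simp⟩
  | succ a ih =>
    obtain ⟨p, hp⟩ := ih
    refine ⟨(p.concat (gp_adj_inner n k hk hkn _)).copy rfl (by push_cast; congr 1; ring),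
      by simp [hp]⟩

lemma gp_walk_outer (n k : ℕ) (hn : 2 < n) (a : ℤ) (i : ZMod n) :
    ∃ p : (genPetersen n k).Walk (Sum.inl i) (Sum.inl (i + a)), (p.length : ℤ) = |a| := by
  obtain ⟨c, rfl | rfl⟩ := Int.eq_nat_or_neg a
  · obtain ⟨p, hp⟩ := gp_walk_outer_nat n k hn c i
    exact ⟨p.copy rfl (by simp), by simp [hp]⟩
  · obtain ⟨p, hp⟩ := gp_walk_outer_nat n k hn c (i - c)
    exact ⟨p.reverse.copy (by simp) (by simp [sub_eq_add_neg]), by simp [hp]⟩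

lemma gp_walk_inner (n k : ℕ) (hk : 0 < k) (hkn : k < n) (a : ℤ) (i : ZMod n) :
    ∃ p : (genPetersen n k).Walk (Sum.inr i) (Sum.inr (i + k * a)), (p.length : ℤ) = |a| := by
  obtain ⟨c, rfl | rfl⟩ := Int.eq_nat_or_neg a
  · obtain ⟨p, hp⟩ := gp_walk_inner_nat n k hk hkn c i
    exact ⟨p.copy rfl (by simp), by simp [hp]⟩
  · obtain ⟨p, hp⟩ := gp_walk_inner_nat n k hk hkn c (i - k * c)
    exact ⟨p.reverse.copy (by simp) (by simp [sub_eq_add_neg]), by simp [hp]⟩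

lemma gp_walk_upper (n k : ℕ) (hn : 2 < n) (hk : 0 < k) (hkn : k < n)
    (x y : ZMod n ⊕ ZMod n) (a b : ℤ)
    (h : gpIdx y - gpIdx x = (a : ZMod n) + k * (b : ZMod n)) :
    ∃ p : (genPetersen n k).Walk x y, (p.length : ℤ) = gpCost x y a b := by
  rcases x with i | i <;> rcases y with j | j <;> simp only [gpIdx] at h <;>
    obtain rfl : j = i + a + k * b := by linear_combination h
  · by_cases hb : b = 0
    · subst hb
      obtain ⟨p, hp⟩ := gp_walk_outer n k hn a i
      exact ⟨p.copy rfl (by simp), by simp [hp, gpCost]⟩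
    · obtain ⟨p, hp⟩ := gp_walk_outer n k hn a i
      obtain ⟨q, hq⟩ := gp_walk_inner n k hk hkn b (i + a)
      refine ⟨p.append (.cons (gp_adj_spoke n k _) (q.concat (gp_adj_spoke n k _).symm)), ?_⟩
      simp [gpCost, hb, hp, hq]; ring
  · obtain ⟨p, hp⟩ := gp_walk_outer n k hn a i
    obtain ⟨q, hq⟩ := gp_walk_inner n k hk hkn b (i + a)
    refine ⟨p.append (.cons (gp_adj_spoke n k _) q), ?_⟩
    simp [gpCost, hp, hq]; ring
  · obtain ⟨p, hp⟩ := gp_walk_outer n k hn a (i + k * b)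
    obtain ⟨q, hq⟩ := gp_walk_inner n k hk hkn b i
    refine ⟨(q.append (.cons (gp_adj_spoke n k _).symm p)).copy rfl (by congr 1; ring), ?_⟩
    simp [gpCost, hp, hq]; ring
  · by_cases ha : a = 0
    · subst ha
      obtain ⟨p, hp⟩ := gp_walk_inner n k hk hkn b i
      exact ⟨p.copy rfl (by simp), by simp [hp, gpCost]⟩
    · obtain ⟨p, hp⟩ := gp_walk_outer n k hn a (i + k * b)
      obtain ⟨q, hq⟩ := gp_walk_inner n k hk hkn b i
      refine ⟨(q.append (.cons (gp_adj_spoke n k _).symm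
        (p.concat (gp_adj_spoke n k _)))).copy rfl (by congr 1; ring), ?_⟩
      simp [gpCost, ha, hp, hq]; ring

lemma gp_dist_upper (n k : ℕ) (hn : 2 < n) (hk : 0 < k) (hkn : k < n)
    (x y : ZMod n ⊕ ZMod n) (a b : ℤ)
    (h : gpIdx y - gpIdx x = (a : ZMod n) + k * (b : ZMod n)) :
    ((genPetersen n k).dist x y : ℤ) ≤ gpCost x y a b := by
  obtain ⟨p, hp⟩ := gp_walk_upper n k hn hk hkn x y a b h
  rw [← hp]
  exact_mod_cast SimpleGraph.dist_le p

lemma gp_dist_lower (n k : ℕ) (hn : 2 < n) (hk : 0 < k) (hkn : k < n)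
    (x y : ZMod n ⊕ ZMod n) :
    ∃ a b : ℤ, gpIdx y - gpIdx x = (a : ZMod n) + k * (b : ZMod n) ∧
      gpCost x y a b ≤ (genPetersen n k).dist x y := by
  have hr : (genPetersen n k).Reachable x y := by
    have : NeZero n := ⟨by omega⟩
    obtain ⟨a, ha⟩ := ZMod.intCast_surjective (gpIdx y - gpIdx x)
    obtain ⟨p, -⟩ := gp_walk_upper n k hn hk hkn x y a 0 (by simp [ha])
    exact ⟨p⟩
  obtain ⟨p, hp⟩ := hr.exists_walk_length_eq_dist
  rw [← hp]
  exact gp_walk_lower n k p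

/-- Lemma K. -/
lemma gp_num_inner (n j : ℤ) (hj : 2 ≤ j) (hn : 7 * j ^ 2 + 8 * j + 2 < n) (a b c : ℤ)
    (hb : |b| ≤ j + 2) (h : n ∣ (2 * j + 1) * b - (a + (2 * j + 1) * c)) :
    |b| ≤ |a| + |c| := by
  by_contra! hlt
  have ha := abs_nonneg a
  have hc := abs_nonneg c
  have h0 := Int.eq_zero_of_abs_lt_dvd h (by
    have h1 : |(2 * j + 1) * b - (a + (2 * j + 1) * c)|
        ≤ (2 * j + 1) * |b| + (|a| + (2 * j + 1) * |c|) := by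
      refine (abs_sub _ _).trans ?_
      gcongr
      · rw [abs_mul, abs_of_nonneg (by omega : 0 ≤ 2 * j + 1)]
      · refine (abs_add_le _ _).trans ?_
        rw [abs_mul, abs_of_nonneg (by omega : 0 ≤ 2 * j + 1)]
    nlinarith)
  have h2 : a = (2 * j + 1) * (b - c) := by linear_combination -h0
  have h3 : |a| = (2 * j + 1) * |b - c| := by
    rw [h2, abs_mul, abs_of_nonneg (by omega : 0 ≤ 2 * j + 1)]
  have h4 : |b| ≤ |b - c| + |c| := by have := abs_add_le (b - c) c; simpa using this
  nlinarith [abs_nonneg (b - c)]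

/-- Lemma J. -/
lemma gp_num_outer (n j : ℤ) (hj : 2 ≤ j) (hn : 7 * j ^ 2 + 8 * j + 2 < n) (a m c : ℤ)
    (hb : |m| ≤ j + 1) (h : n ∣ m - (a + (2 * j + 1) * c)) :
    |m| ≤ |a| + |c| := by
  by_contra! hlt
  have ha := abs_nonneg a
  have hc := abs_nonneg c
  have h0 := Int.eq_zero_of_abs_lt_dvd h (by
    have h1 : |m - (a + (2 * j + 1) * c)|
        ≤ |m| + (|a| + (2 * j + 1) * |c|) := by
      refine (abs_sub _ _).trans ?_
      gcongr
      · refine (abs_add_le _ _).trans ?_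
        rw [abs_mul, abs_of_nonneg (by omega : 0 ≤ 2 * j + 1)]
    nlinarith)
  have h2 : (2 * j + 1) * c = m - a := by linear_combination -h0
  have h3 : (2 * j + 1) * |c| ≤ |m| + |a| := by
    have := abs_sub m a
    rwa [← h2, abs_mul, abs_of_nonneg (by omega : 0 ≤ 2 * j + 1)] at this
  rcases eq_or_ne c 0 with rfl | hc0
  · have : a = m := by linarith
    subst this; simp at hlt
  · have : 1 ≤ |c| := Int.one_le_abs hc0
    nlinarith

/-- Separation of the two families of indices. -/
lemma gp_num_sep (n j : ℤ) (hj : 2 ≤ j) (hn : 7 * j ^ 2 + 8 * j + 2 < n) (a b : ℤ)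
    (hb : |b| ≤ j + 2) (hb0 : b ≠ 0) (h : n ∣ (2 * j + 1) * b - a) :
    |b| + 2 ≤ |a| ∧ j + 2 ≤ |a| := by
  by_contra! hlt
  have ha := abs_nonneg a
  have ha2 : |a| ≤ j + 4 := by
    by_contra! h4
    have := hlt (by omega)
    omega
  have hb1 : 1 ≤ |b| := Int.one_le_abs hb0
  have h0 := Int.eq_zero_of_abs_lt_dvd h (by
    have h1 : |(2 * j + 1) * b - a| ≤ (2 * j + 1) * |b| + |a| := by
      refine (abs_sub _ _).trans ?_
      rw [abs_mul, abs_of_nonneg (by omega : 0 ≤ 2 * j + 1)]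
    nlinarith)
  have h2 : a = (2 * j + 1) * b := by linear_combination -h0
  have h3 : |a| = (2 * j + 1) * |b| := by
    rw [h2, abs_mul, abs_of_nonneg (by omega : 0 ≤ 2 * j + 1)]
  have := hlt (by nlinarith)
  nlinarith

lemma closer_sub {V : Type*} [Fintype V] (G : SimpleGraph V) (x y : V) :
    ((closerSet G x y).ncard : ℤ) - (closerSet G y x).ncard =
      ∑ w : V, Int.sign ((G.dist w y : ℤ) - G.dist w x) := by
  classical
  have e : ∀ x y : V, ((closerSet G x y).ncard : ℤ) =
      ∑ w : V, if G.dist w x < G.dist w y then 1 else 0 := by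
    intro x y
    have hs : closerSet G x y =
        ((Finset.univ.filter fun w => G.dist w x < G.dist w y : Finset V) : Set V) := by
      ext w
      simp [closerSet]
    rw [hs, Set.ncard_coe_finset, Finset.sum_boole]
  rw [e, e, ← Finset.sum_sub_distrib]
  refine Finset.sum_congr rfl fun w _ => ?_
  rcases lt_trichotomy (G.dist w x) (G.dist w y) with h | h | h
  · rw [Int.sign_eq_one_of_pos (by omega)]; simp [h, h.le]
  · simp [h]
  · rw [Int.sign_eq_neg_one_of_neg (by omega)]; simp [h, h.le]

theorem stmt_7 (n k : ℕ) (hk : 5 ≤ k) (hko : Odd k)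
    (hn : 7 * k ^ 2 + 3 * k < 4 * n) (hkn : 2 * k < n) :
    ¬ IsLDistBalanced (genPetersen n k) 2 := by
  classical
  intro hbal
  obtain ⟨j, hkj⟩ := hko
  have hj : (2 : ℤ) ≤ j := by omega
  have hnz : 7 * (j : ℤ) ^ 2 + 8 * j + 2 < n := by
    subst hkj; zify at hn; nlinarith
  have : NeZero n := ⟨by omega⟩
  have hk' : ((k : ℕ) : ZMod n) = ((2 * j + 1 : ℤ) : ZMod n) := by rw [hkj]; push_cast; rfl
  have lower := gp_dist_lower n k (by omega) (by omega) (by omega)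
  have upper := gp_dist_upper n k (by omega) (by omega) (by omega)
  have todvd : ∀ p q : ℤ, (p : ZMod n) = (q : ZMod n) → (n : ℤ) ∣ p - q := by
    intro p q h
    rw [← ZMod.intCast_eq_intCast_iff_dvd_sub]
    exact h.symm
  rw [hk'] at lower upper
  set G := genPetersen n k with hG
  -- translation invariance
  have transl : ∀ i j' i' j'' : ZMod n, j' - i = j'' - i' →
      G.dist (Sum.inr i) (Sum.inl j') = G.dist (Sum.inr i') (Sum.inl j'') := by
    have key : ∀ i j' i' j'' : ZMod n, j' - i = j'' - i' →
        G.dist (Sum.inr i) (Sum.inl j') ≤ G.dist (Sum.inr i') (Sum.inl j'') := by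
      intro i j' i' j'' h
      obtain ⟨a, b, hab, hc⟩ := lower (Sum.inr i') (Sum.inl j'')
      have := upper (Sum.inr i) (Sum.inl j') a b (by simp only [gpIdx] at hab ⊢; rw [h, hab])
      simp only [gpCost] at this hc
      omega
    intro i j' i' j'' h
    exact le_antisymm (key _ _ _ _ h) (key _ _ _ _ h.symm)
  have hd2 : G.dist (Sum.inl 0) (Sum.inr 1) = 2 := by
    obtain ⟨a, b, hab, hc⟩ := lower (Sum.inl 0) (Sum.inr 1)
    have h2 := upper (Sum.inl 0) (Sum.inr 1) 1 0 (by simp [gpIdx])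
    simp only [gpCost, gpIdx] at hab hc h2
    have : a ≠ 0 ∨ b ≠ 0 := by
      by_contra! hh
      obtain ⟨rfl, rfl⟩ := hh
      have : Fact (1 < n) := ⟨by omega⟩
      simp at hab
    have h1 : 1 ≤ |a| + |b| := by
      have ha := abs_nonneg a
      have hb := abs_nonneg b
      rcases this with h | h
      · have := Int.one_le_abs h
        omega
      · have := Int.one_le_abs h
        omega
    simp at h2
    omega
  have heq := hbal _ _ hd2
  have hsub := closer_sub G (Sum.inl 0) (Sum.inr 1)
  rw [heq, sub_self, Fintype.sum_sum_type,
    ← Equiv.sum_comp (Equiv.subLeft (1 : ZMod n))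
      (fun m => Int.sign ((G.dist (Sum.inr m) (Sum.inr 1) : ℤ) - G.dist (Sum.inr m) (Sum.inl 0))),
    ← Finset.sum_add_distrib] at hsub
  simp only [Equiv.subLeft_apply] at hsub
  set A : Finset (ZMod n) :=
    ((Finset.Icc (-(j + 1) : ℤ) (j + 1)).erase 0).image (fun m : ℤ => (m : ZMod n)) with hA
  set B : Finset (ZMod n) :=
    ((Finset.Icc (-(j + 2) : ℤ) (j + 2)).erase 0).image
      (fun b : ℤ => (((2 * j + 1) * b : ℤ) : ZMod n)) with hB
  have hAcard : (A.card : ℤ) ≤ 2 * j + 2 := by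
    have : A.card ≤ 2 * j + 2 := by
      refine Finset.card_image_le.trans ?_
      rw [Finset.card_erase_of_mem (by simp; omega), Int.card_Icc]
      omega
    exact_mod_cast this
  have hBcard : (B.card : ℤ) = 2 * j + 4 := by
    have : B.card = 2 * j + 4 := by
      rw [hB, Finset.card_image_of_injOn, Finset.card_erase_of_mem (by simp; omega), Int.card_Icc]
      · omega
      · intro b hb b' hb' h
        simp only [Finset.coe_erase, Set.mem_sdiff, Finset.mem_coe, Finset.mem_Icc,
          Set.mem_singleton_iff] at hb hb'
        have hdv := todvd _ _ h
        have h1 : |b - b'| ≤ 2 * j + 4 := by rw [abs_le]; omega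
        have h0 := Int.eq_zero_of_abs_lt_dvd hdv (by
          rw [← mul_sub, abs_mul, abs_of_nonneg (by omega : 0 ≤ 2 * (j : ℤ) + 1)]
          nlinarith)
        rw [← mul_sub] at h0
        rcases mul_eq_zero.1 h0 with h0 | h0 <;> omega
    exact_mod_cast this
  have main : ∀ m : ZMod n,
      Int.sign ((G.dist (Sum.inl m) (Sum.inr 1) : ℤ) - G.dist (Sum.inl m) (Sum.inl 0)) +
      Int.sign ((G.dist (Sum.inr (1 - m)) (Sum.inr 1) : ℤ) - G.dist (Sum.inr (1 - m)) (Sum.inl 0))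
      ≤ (if m ∈ A then 1 else 0) + (if m = ((-(j + 1) : ℤ) : ZMod n) then 1 else 0)
        - (if m ∈ B then 1 else 0) := by
    intro m
    have hx : G.dist (Sum.inr (1 - m)) (Sum.inl 0) = G.dist (Sum.inl m) (Sum.inr 1) := by
      rw [SimpleGraph.dist_comm (u := Sum.inl m)]
      exact transl _ _ _ _ (by ring)
    rw [hx]
    obtain ⟨a, b, hab, hf⟩ := lower (Sum.inl 0) (Sum.inl m)
    obtain ⟨a', b', hab', hx'⟩ := lower (Sum.inr 1) (Sum.inl m)
    have uf := upper (Sum.inl 0) (Sum.inl m)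
    have ux := upper (Sum.inr 1) (Sum.inl m)
    have uh := upper (Sum.inr (1 - m)) (Sum.inr 1)
    rw [SimpleGraph.dist_comm (u := Sum.inl m) (v := Sum.inl 0),
      SimpleGraph.dist_comm (u := Sum.inl m) (v := Sum.inr 1)]
    simp only [gpIdx, gpCost, sub_zero, sub_sub_cancel] at hab hf hab' hx' uf ux uh
    generalize (G.dist (Sum.inl 0) (Sum.inl m)) = f at *
    generalize (G.dist (Sum.inr 1) (Sum.inl m)) = x at *
    generalize (G.dist (Sum.inr (1 - m)) (Sum.inr 1)) = h at *
    have s1 : ∀ z : ℤ, (z < 0 ∧ z.sign = -1) ∨ (z = 0 ∧ z.sign = 0) ∨ (0 < z ∧ z.sign = 1) := by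
      intro z
      rcases lt_trichotomy z 0 with h | h | h
      · exact Or.inl ⟨h, Int.sign_eq_neg_one_of_neg h⟩
      · exact Or.inr (Or.inl ⟨h, by simp [h]⟩)
      · exact Or.inr (Or.inr ⟨h, Int.sign_eq_one_of_pos h⟩)
    have t1 := s1 ((x : ℤ) - f)
    have t2 := s1 ((h : ℤ) - x)
    by_cases hmB : m ∈ B
    · -- m = k c
      rw [if_pos hmB]
      rw [hB] at hmB
      simp only [Finset.mem_image, Finset.mem_erase, Finset.mem_Icc] at hmB
      obtain ⟨c, ⟨hc0, hc1, hc2⟩, rfl⟩ := hmB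
      have hc : |c| ≤ j + 2 := by rw [abs_le]; omega
      have e1 : (h : ℤ) ≤ |c| := by
        have := uh 0 c (by push_cast; ring)
        simpa using this
      have e2 : (x : ℤ) ≤ |c| + 2 := by
        have := ux (-1) c (by push_cast; ring)
        simp only [abs_neg, abs_one] at this
        omega
      have e3 : |c| ≤ x := by
        have := gp_num_inner n j hj hnz (a' + 1) c b' hc (todvd _ _ (by
          push_cast at hab' ⊢; linear_combination hab'))
        have := abs_add_le a' 1
        simp only [abs_one] at this
        omega
      have e4 : |c| + 2 ≤ f := by
        by_cases hb : b = 0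
        · subst hb
          have := gp_num_sep n j hj hnz a c hc hc0 (todvd _ _ (by
            push_cast at hab ⊢; linear_combination hab))
          simp at hf
          omega
        · have := gp_num_inner n j hj hnz a c b hc (todvd _ _ (by
            push_cast at hab ⊢; linear_combination hab))
          rw [if_neg hb] at hf
          omega
      split_ifs <;> omega
    · rw [if_neg hmB]
      by_cases hmA : m ∈ A
      · rw [if_pos hmA]
        by_cases hm1 : m = ((-(j + 1) : ℤ) : ZMod n)
        · rw [if_pos hm1]; omega
        · rw [if_neg hm1]
          rw [hA] at hmA
          simp only [Finset.mem_image, Finset.mem_erase, Finset.mem_Icc] at hmA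
          obtain ⟨M, ⟨hM0, hM1, hM2⟩, rfl⟩ := hmA
          have hM3 : M ≠ -(j + 1) := by rintro rfl; exact hm1 rfl
          have hM : |M| ≤ j + 1 := by rw [abs_le]; omega
          have e1 : |M| ≤ f := by
            have := gp_num_outer n j hj hnz a M b hM (todvd _ _ (by
              push_cast at hab ⊢; linear_combination hab))
            split_ifs at hf <;> omega
          have e2 : (h : ℤ) ≤ |M| + 2 := by
            have := uh M 0 (by simp)
            rw [if_neg hM0] at this
            simpa using this
          rcases lt_or_gt_of_ne hM0 with hneg | hpos
          · have e3 : |M - 1| ≤ |a'| + |b'| :=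
              gp_num_outer n j hj hnz a' (M - 1) b' (by rw [abs_le]; omega) (todvd _ _ (by
                push_cast at hab' ⊢; linear_combination hab'))
            rw [abs_of_neg hneg] at *
            rw [abs_of_neg (by omega : M - 1 < 0)] at e3
            omega
          · have e3 := ux (M - 1) 0 (by push_cast; ring)
            rw [abs_of_pos hpos] at *
            rw [abs_of_nonneg (by omega : 0 ≤ M - 1)] at e3
            simp at e3
            omega
      · rw [if_neg hmA]
        have e : (h : ℤ) ≤ f := by
          by_cases hb : b = 0
          · subst hb
            simp only [Int.cast_zero, mul_zero, add_zero] at hab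
            subst hab
            simp at hf
            by_cases ha0 : a = 0
            · subst ha0
              have := uh 0 0 (by simp)
              simp at this
              omega
            · have ha : ¬ (-(j + 1) ≤ a ∧ a ≤ j + 1) := by
                intro hh
                exact hmA (Finset.mem_image.2 ⟨a, by simp [ha0]; omega, rfl⟩)
              rcases lt_or_gt_of_ne ha0 with hneg | hpos
              · have := uh (a + (2 * j + 1)) (-1) (by push_cast; ring)
                simp only [abs_neg, abs_one] at this
                rcases abs_cases a with hq | hq <;>
                  rcases abs_cases (a + (2 * (j : ℤ) + 1)) with hr | hr <;>
                  split_ifs at this <;> omega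
              · have := uh (a - (2 * j + 1)) 1 (by push_cast; ring)
                simp only [abs_one] at this
                rcases abs_cases a with hq | hq <;>
                  rcases abs_cases (a - (2 * (j : ℤ) + 1)) with hr | hr <;>
                  split_ifs at this <;> omega
          · have := uh a b hab
            rw [if_neg hb] at hf
            split_ifs at this <;> omega
        split_ifs <;> omega
  have hfin := Finset.sum_le_sum fun m (_ : m ∈ (Finset.univ : Finset (ZMod n))) => main m
  rw [← hsub, Finset.sum_sub_distrib, Finset.sum_add_distrib] at hfin
  simp only [Finset.sum_ite_mem, Finset.sum_ite_eq', Finset.univ_inter,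
    Finset.mem_univ, if_true, Finset.sum_const, nsmul_eq_mul, mul_one] at hfin
  omega
end

section
/- If k = 2 and n > 10, or k = 3 and n > 10, or k = 4 and n > 21 (with k < n/2), then the generalized Petersen graph GP(n,k) is not 2-distance-balanced. -/
namespace GPAux

/-- Cost of moving by `a` using inner jumps of length `k` and outer steps. -/
def cst (k a : ℕ) : ℕ := a / k + min (a % k) (k + 1 - a % k)

def duu (k a : ℕ) : ℕ := min a (2 + cst k a)
def duv (k a : ℕ) : ℕ := 1 + cst k a
def dvv (k a : ℕ) : ℕ := if a % k = 0 then a / k else 2 + cst k a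

def fuu (n k a : ℕ) : ℕ := min (duu k a) (duu k (n - a))
def fuv (n k a : ℕ) : ℕ := min (duv k a) (duv k (n - a))
def fvv (n k a : ℕ) : ℕ := min (dvv k a) (dvv k (n - a))

/-- Graph distance is determined by a `1`-Lipschitz function with descent. -/
lemma dist_eq_of {V : Type*} (G : SimpleGraph V) (y : V) (f : V → ℕ) (hy : f y = 0)
    (h0 : ∀ w, f w = 0 → w = y)
    (hlip : ∀ w w', G.Adj w w' → f w ≤ f w' + 1)
    (hdesc : ∀ w, f w ≠ 0 → ∃ w', G.Adj w w' ∧ f w' < f w) (w : V) :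
    G.dist w y = f w := by
  have hwalk : ∀ m, ∀ w, f w ≤ m → ∃ p : G.Walk w y, p.length ≤ f w := by
    intro m
    induction m with
    | zero =>
      intro w hw
      obtain rfl := h0 w (by omega)
      exact ⟨SimpleGraph.Walk.nil, by simp⟩
    | succ m ih =>
      intro w hw
      by_cases hz : f w = 0
      · obtain rfl := h0 w hz
        exact ⟨SimpleGraph.Walk.nil, by simp⟩
      · obtain ⟨w', hadj, hlt⟩ := hdesc w hz
        obtain ⟨p, hp⟩ := ih w' (by omega)
        refine ⟨SimpleGraph.Walk.cons hadj p, ?_⟩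
        simp only [SimpleGraph.Walk.length_cons]
        omega
  have hlow : ∀ (u v : V) (p : G.Walk u v), f u ≤ f v + p.length := by
    intro u v p
    induction p with
    | nil => simp
    | cons h p ih =>
      have := hlip _ _ h
      simp only [SimpleGraph.Walk.length_cons]
      omega
  obtain ⟨p, hp⟩ := hwalk _ w le_rfl
  apply le_antisymm
  · exact (SimpleGraph.dist_le p).trans hp
  · obtain ⟨p', hp'⟩ := SimpleGraph.Reachable.exists_walk_length_eq_dist ⟨p⟩
    have := hlow _ _ p'
    omega

/-- Shift up and down modulo `n` on representatives. -/
def up (n c a : ℕ) : ℕ := if a + c < n then a + c else a + c - n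
def dn (n c a : ℕ) : ℕ := if c ≤ a then a - c else a + n - c

lemma val_add_nat {n : ℕ} [NeZero n] (j : ZMod n) (c : ℕ) (hc : c < n) :
    (j + (c : ZMod n)).val = up n c j.val := by
  have hj := ZMod.val_lt j
  rw [ZMod.val_add, ZMod.val_natCast, Nat.mod_eq_of_lt hc]
  unfold up
  split_ifs with h
  · exact Nat.mod_eq_of_lt h
  · rw [Nat.mod_eq_sub_mod (by omega)]
    exact Nat.mod_eq_of_lt (by omega)

lemma val_sub_nat {n : ℕ} [NeZero n] (j : ZMod n) (c : ℕ) (hc : c < n) :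
    (j - (c : ZMod n)).val = dn n c j.val := by
  have h := val_add_nat (j - (c : ZMod n)) c hc
  have hj := ZMod.val_lt j
  have hj' := ZMod.val_lt (j - (c : ZMod n))
  rw [sub_add_cancel] at h
  unfold up at h
  unfold dn
  split_ifs at h ⊢ <;> omega

lemma cst_add {k : ℕ} (hk : 0 < k) (a : ℕ) : cst k (a + k) = cst k a + 1 := by
  simp only [cst, Nat.add_div_right a hk, Nat.add_mod_right]; omega

lemma duv_add {k : ℕ} (hk : 0 < k) (a : ℕ) : duv k (a + k) = duv k a + 1 := by
  simp only [duv, cst_add hk]; omega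

lemma dvv_add {k : ℕ} (hk : 0 < k) (a : ℕ) : dvv k (a + k) = dvv k a + 1 := by
  simp only [dvv, cst_add hk, Nat.add_div_right a hk, Nat.add_mod_right]; split_ifs <;> omega

def K (k : ℕ) : Prop := k = 2 ∨ k = 3 ∨ k = 4

lemma K.pos {k : ℕ} (hk : K k) : 0 < k := by rcases hk with rfl | rfl | rfl <;> omega

lemma duu_add {k : ℕ} (hk : K k) {a : ℕ} (ha : 6 ≤ a) : duu k (a + k) = duu k a + 1 := by
  simp only [duu, cst_add hk.pos]
  rcases hk with rfl | rfl | rfl <;> simp only [cst] <;> omega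

lemma duu_one {k : ℕ} (hk : K k) (a : ℕ) :
    duu k (a + 1) ≤ duu k a + 1 ∧ duu k a ≤ duu k (a + 1) + 1 := by
  rcases hk with rfl | rfl | rfl <;> simp only [duu, cst] <;> omega

lemma duv_one {k : ℕ} (hk : K k) (a : ℕ) :
    duv k (a + 1) ≤ duv k a + 1 ∧ duv k a ≤ duv k (a + 1) + 1 := by
  rcases hk with rfl | rfl | rfl <;> simp only [duv, cst] <;> omega

lemma duv_refl {k : ℕ} (hk : K k) {b c : ℕ} (hbc : b + c = k) :
    duv k b ≤ duv k c + 1 ∧ duv k b ≤ 3 := by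
  rcases hk with rfl | rfl | rfl <;> simp only [duv, cst] <;> omega

lemma dvv_refl {k : ℕ} (hk : K k) {b c : ℕ} (hbc : b + c = k) :
    dvv k b ≤ dvv k c + 1 ∧ dvv k b ≤ 4 := by
  obtain rfl : c = k - b := by omega
  have hb : b ≤ k := by omega
  clear hbc
  rcases hk with rfl | rfl | rfl <;> interval_cases b <;> simp [dvv, cst]

lemma duu_uv {k : ℕ} (hk : K k) (a : ℕ) :
    duu k a ≤ duv k a + 1 ∧ duv k a ≤ duu k a + 1 := by
  rcases hk with rfl | rfl | rfl <;> simp only [duv, duu, cst] <;> omega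

lemma dvv_uv {k : ℕ} (hk : K k) (a : ℕ) :
    dvv k a ≤ duv k a + 1 ∧ duv k a ≤ dvv k a + 1 := by
  rcases hk with rfl | rfl | rfl <;> simp only [duv, dvv, cst] <;> split_ifs <;> omega

lemma far {k : ℕ} (hk : K k) {a : ℕ} (ha : 2 * k + 2 ≤ a) : 3 ≤ dvv k a ∧ 3 ≤ duv k a := by
  rcases hk with rfl | rfl | rfl <;> simp only [duv, dvv, cst] <;> split_ifs <;> omega

lemma mono_uu {k : ℕ} (hk : K k) {a b : ℕ} (h : a + 12 ≤ b) : duu k a ≤ duu k b := by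
  rcases hk with rfl | rfl | rfl <;> simp only [duu, cst] <;> omega

lemma mono_uv {k : ℕ} (hk : K k) {a b : ℕ} (h : a + 12 ≤ b) : duv k a ≤ duv k b := by
  rcases hk with rfl | rfl | rfl <;> simp only [duv, cst] <;> omega

lemma mono_vv {k : ℕ} (hk : K k) {a b : ℕ} (h : a + 12 ≤ b) : dvv k a ≤ dvv k b := by
  rcases hk with rfl | rfl | rfl <;> simp only [dvv, cst] <;> split_ifs <;> omega

lemma d_desc_uu {k : ℕ} (hk : K k) {a : ℕ} (ha : 0 < a) :
    duu k (a - 1) < duu k a ∨ duv k a < duu k a := by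
  rcases hk with rfl | rfl | rfl <;> simp only [duu, duv, cst] <;> omega

lemma d_desc_uv {k : ℕ} (hk : K k) (a : ℕ) :
    (0 < a ∧ duv k (a - 1) < duv k a) ∨ duv k (a + 1) < duv k a ∨ dvv k a < duv k a := by
  rcases hk with rfl | rfl | rfl <;> simp only [dvv, duv, cst] <;> split_ifs <;> omega

lemma d_desc_vu {k : ℕ} (hk : K k) {a : ℕ} (ha : a < k) :
    duv k (k - a) < duv k a ∨ duu k a < duv k a := by
  rcases hk with rfl | rfl | rfl <;> interval_cases a <;> simp [duu, duv, cst]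

lemma d_desc_vv {k : ℕ} (hk : K k) {a : ℕ} (ha : a < k) (h0 : 0 < a) : duv k a < dvv k a := by
  rcases hk with rfl | rfl | rfl <;> interval_cases a <;> simp [dvv, duv, cst]

lemma uu_l (n k a : ℕ) : fuu n k a ≤ duu k a := min_le_left _ _
lemma uv_l (n k a : ℕ) : fuv n k a ≤ duv k a := min_le_left _ _
lemma vv_l (n k a : ℕ) : fvv n k a ≤ dvv k a := min_le_left _ _
lemma uu_r {n k a b : ℕ} (h : a + b = n) : fuu n k a ≤ duu k b := by
  obtain rfl : b = n - a := by omega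
  exact min_le_right _ _
lemma uv_r {n k a b : ℕ} (h : a + b = n) : fuv n k a ≤ duv k b := by
  obtain rfl : b = n - a := by omega
  exact min_le_right _ _
lemma vv_r {n k a b : ℕ} (h : a + b = n) : fvv n k a ≤ dvv k b := by
  obtain rfl : b = n - a := by omega
  exact min_le_right _ _
lemma uu_c {n k a b : ℕ} (h : a + b = n) : fuu n k a = duu k a ∨ fuu n k a = duu k b := by
  obtain rfl : b = n - a := by omega
  exact min_choice _ _
lemma uv_c {n k a b : ℕ} (h : a + b = n) : fuv n k a = duv k a ∨ fuv n k a = duv k b := by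
  obtain rfl : b = n - a := by omega
  exact min_choice _ _
lemma vv_c {n k a b : ℕ} (h : a + b = n) : fvv n k a = dvv k a ∨ fvv n k a = dvv k b := by
  obtain rfl : b = n - a := by omega
  exact min_choice _ _

def Good (n k : ℕ) : Prop := (k = 2 ∧ 10 < n) ∨ (k = 3 ∧ 10 < n) ∨ (k = 4 ∧ 21 < n)

lemma Good.K {n k : ℕ} (h : Good n k) : K k := by
  rcases h with ⟨rfl, _⟩ | ⟨rfl, _⟩ | ⟨rfl, _⟩ <;> simp [GPAux.K]

lemma Good.big {n k : ℕ} (h : Good n k) : 3 * k + 2 ≤ n := by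
  rcases h with ⟨rfl, _⟩ | ⟨rfl, _⟩ | ⟨rfl, _⟩ <;> omega

lemma lip_uu {n k : ℕ} (h : Good n k) {a : ℕ} (ha : a < n) :
    fuu n k a ≤ fuu n k (up n 1 a) + 1 ∧ fuu n k (up n 1 a) ≤ fuu n k a + 1 := by
  obtain ⟨b, rfl⟩ : ∃ b, n = a + (b + 1) := ⟨n - a - 1, by omega⟩
  have h1 := duu_one h.K a
  have h2 := duu_one h.K b
  have a1 := uu_l (a + (b + 1)) k a
  have a2 := uu_r (k := k) (rfl : a + (b + 1) = _)
  have a3 := uu_c (k := k) (rfl : a + (b + 1) = _)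
  unfold up
  split_ifs with hs
  · have b1 := uu_l (a + (b + 1)) k (a + 1)
    have b2 := uu_r (k := k) (by omega : (a + 1) + b = a + (b + 1))
    have b3 := uu_c (k := k) (by omega : (a + 1) + b = a + (b + 1))
    omega
  · obtain rfl : b = 0 := by omega
    have h0 : duu k 0 = 0 := by simp [duu]
    have b1 := uu_l (a + (0 + 1)) k 0
    rw [show a + 1 - (a + (0 + 1)) = 0 by omega]
    omega

lemma lip_uv {n k : ℕ} (h : Good n k) {a : ℕ} (ha : a < n) :
    fuv n k a ≤ fuv n k (up n 1 a) + 1 ∧ fuv n k (up n 1 a) ≤ fuv n k a + 1 := by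
  obtain ⟨b, rfl⟩ : ∃ b, n = a + (b + 1) := ⟨n - a - 1, by omega⟩
  have h1 := duv_one h.K a
  have h2 := duv_one h.K b
  have a1 := uv_l (a + (b + 1)) k a
  have a2 := uv_r (k := k) (rfl : a + (b + 1) = _)
  have a3 := uv_c (k := k) (rfl : a + (b + 1) = _)
  unfold up
  split_ifs with hs
  · have b1 := uv_l (a + (b + 1)) k (a + 1)
    have b2 := uv_r (k := k) (by omega : (a + 1) + b = a + (b + 1))
    have b3 := uv_c (k := k) (by omega : (a + 1) + b = a + (b + 1))
    omega
  · obtain rfl : b = 0 := by omega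
    have b1 := uv_l (a + (0 + 1)) k 0
    have b2 := uv_r (k := k) (by omega : 0 + (a + 1) = a + (0 + 1))
    have b3 := uv_c (k := k) (by omega : 0 + (a + 1) = a + (0 + 1))
    rw [show a + 1 - (a + (0 + 1)) = 0 by omega]
    omega

lemma lip_uvk {n k : ℕ} (h : Good n k) {a : ℕ} (ha : a < n) :
    fuv n k a ≤ fuv n k (up n k a) + 1 ∧ fuv n k (up n k a) ≤ fuv n k a + 1 := by
  have hp := h.K.pos
  have hb := h.big
  have a1 := uv_l n k a
  unfold up
  split_ifs with hs
  · obtain ⟨b, rfl⟩ : ∃ b, n = a + (b + k) := ⟨n - a - k, by omega⟩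
    have h1 := duv_add hp a
    have h2 := duv_add hp b
    have a2 := uv_r (k := k) (rfl : a + (b + k) = _)
    have a3 := uv_c (k := k) (rfl : a + (b + k) = _)
    have b1 := uv_l (a + (b + k)) k (a + k)
    have b2 := uv_r (k := k) (by omega : (a + k) + b = a + (b + k))
    have b3 := uv_c (k := k) (by omega : (a + k) + b = a + (b + k))
    omega
  · obtain ⟨b, hbb⟩ : ∃ b, b = a + k - n := ⟨_, rfl⟩
    rw [← hbb]
    have h1 := duv_refl h.K (by omega : b + (n - a) = k)
    have h2 := duv_refl h.K (by omega : (n - a) + b = k)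
    have a2 := uv_r (k := k) (by omega : a + (n - a) = n)
    have a3 := uv_c (k := k) (by omega : a + (n - a) = n)
    have b1 := uv_l n k b
    have b2 := uv_r (k := k) (by omega : b + (n - b) = n)
    have b3 := uv_c (k := k) (by omega : b + (n - b) = n)
    have f1 := far h.K (by omega : 2 * k + 2 ≤ a)
    have f2 := far h.K (by omega : 2 * k + 2 ≤ n - b)
    omega

lemma lip_vv {n k : ℕ} (h : Good n k) {a : ℕ} (ha : a < n) :
    fvv n k a ≤ fvv n k (up n k a) + 1 ∧ fvv n k (up n k a) ≤ fvv n k a + 1 := by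
  have hp := h.K.pos
  have hb := h.big
  have a1 := vv_l n k a
  unfold up
  split_ifs with hs
  · obtain ⟨b, rfl⟩ : ∃ b, n = a + (b + k) := ⟨n - a - k, by omega⟩
    have h1 := dvv_add hp a
    have h2 := dvv_add hp b
    have a2 := vv_r (k := k) (rfl : a + (b + k) = _)
    have a3 := vv_c (k := k) (rfl : a + (b + k) = _)
    have b1 := vv_l (a + (b + k)) k (a + k)
    have b2 := vv_r (k := k) (by omega : (a + k) + b = a + (b + k))
    have b3 := vv_c (k := k) (by omega : (a + k) + b = a + (b + k))
    omega
  · obtain ⟨b, hbb⟩ : ∃ b, b = a + k - n := ⟨_, rfl⟩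
    rw [← hbb]
    have h1 := dvv_refl h.K (by omega : b + (n - a) = k)
    have h2 := dvv_refl h.K (by omega : (n - a) + b = k)
    have a2 := vv_r (k := k) (by omega : a + (n - a) = n)
    have a3 := vv_c (k := k) (by omega : a + (n - a) = n)
    have b1 := vv_l n k b
    have b2 := vv_r (k := k) (by omega : b + (n - b) = n)
    have b3 := vv_c (k := k) (by omega : b + (n - b) = n)
    have f1 := far h.K (by omega : 2 * k + 2 ≤ a)
    have f2 := far h.K (by omega : 2 * k + 2 ≤ n - b)
    omega

lemma lip_u {n k : ℕ} (h : Good n k) (a : ℕ) :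
    fuu n k a ≤ fuv n k a + 1 ∧ fuv n k a ≤ fuu n k a + 1 := by
  have h1 := duu_uv h.K a
  have h2 := duu_uv h.K (n - a)
  unfold fuu fuv
  omega

lemma lip_v {n k : ℕ} (h : Good n k) (a : ℕ) :
    fvv n k a ≤ fuv n k a + 1 ∧ fuv n k a ≤ fvv n k a + 1 := by
  have h1 := dvv_uv h.K a
  have h2 := dvv_uv h.K (n - a)
  unfold fvv fuv
  omega

lemma desc_uu {n k : ℕ} (h : Good n k) {a : ℕ} (ha : a < n) (hz : fuu n k a ≠ 0) :
    fuu n k (up n 1 a) < fuu n k a ∨ fuu n k (dn n 1 a) < fuu n k a ∨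
      fuv n k a < fuu n k a := by
  have ha0 : 0 < a := by
    rcases Nat.eq_zero_or_pos a with rfl | h0
    · simp [fuu, duu] at hz
    · exact h0
  have h1 := d_desc_uu h.K ha0
  have h2 := d_desc_uu h.K (by omega : 0 < n - a)
  have v1 := uv_l n k a
  have v2 := uv_r (k := k) (by omega : a + (n - a) = n)
  have c := uu_c (k := k) (by omega : a + (n - a) = n)
  have d : fuu n k (dn n 1 a) ≤ duu k (a - 1) := by
    rw [dn, if_pos (by omega)]
    exact uu_l _ _ _
  have u : fuu n k (up n 1 a) ≤ duu k (n - a - 1) := by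
    unfold up
    split_ifs with hs
    · exact uu_r (by omega)
    · rw [show n - a - 1 = a + 1 - n by omega]
      exact uu_l _ _ _
  omega

lemma desc_vu {n k : ℕ} (h : Good n k) {a : ℕ} (ha : a < n) :
    fuv n k (up n k a) < fuv n k a ∨ fuv n k (dn n k a) < fuv n k a ∨
      fuu n k a < fuv n k a := by
  have hp := h.K.pos
  have hb := h.big
  have v1 := uu_l n k a
  have v2 := uu_r (k := k) (by omega : a + (n - a) = n)
  rcases uv_c (k := k) (by omega : a + (n - a) = n) with c | c
  · by_cases hak : k ≤ a
    · have d : fuv n k (dn n k a) ≤ duv k (a - k) := by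
        rw [dn, if_pos hak]
        exact uv_l _ _ _
      have h1 := duv_add hp (a - k)
      rw [Nat.sub_add_cancel hak] at h1
      omega
    · have d : fuv n k (dn n k a) ≤ duv k (k - a) := by
        rw [dn, if_neg hak]
        exact uv_r (by omega)
      have h1 := d_desc_vu h.K (by omega : a < k)
      omega
  · by_cases hak : k ≤ n - a
    · have u : fuv n k (up n k a) ≤ duv k (n - a - k) := by
        unfold up
        split_ifs with hs
        · exact uv_r (by omega)
        · rw [show n - a - k = a + k - n by omega]
          exact uv_l _ _ _
      have h1 := duv_add hp (n - a - k)
      rw [Nat.sub_add_cancel hak] at h1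
      omega
    · have u : fuv n k (up n k a) ≤ duv k (k - (n - a)) := by
        rw [up, if_neg (by omega), show a + k - n = k - (n - a) by omega]
        exact uv_l _ _ _
      have h1 := d_desc_vu h.K (by omega : n - a < k)
      omega

lemma desc_uv {n k : ℕ} (h : Good n k) {a : ℕ} (ha : a < n) :
    fuv n k (up n 1 a) < fuv n k a ∨ fuv n k (dn n 1 a) < fuv n k a ∨
      fvv n k a < fuv n k a := by
  have h1 := d_desc_uv h.K a
  have h2 := d_desc_uv h.K (n - a)
  have v1 := vv_l n k a
  have v2 := vv_r (k := k) (by omega : a + (n - a) = n)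
  have c := uv_c (k := k) (by omega : a + (n - a) = n)
  have d : 0 < a → fuv n k (dn n 1 a) ≤ duv k (a - 1) := by
    intro h0
    rw [dn, if_pos (by omega)]
    exact uv_l _ _ _
  have d' : fuv n k (dn n 1 a) ≤ duv k (n - a + 1) ∨ a = 0 := by
    by_cases h0 : a = 0
    · exact Or.inr h0
    · left
      rw [dn, if_pos (by omega)]
      exact uv_r (by omega)
  have z : a = 0 → fvv n k a < fuv n k a := by
    rintro rfl
    have : fvv n k 0 = 0 := by simp [fvv, dvv]
    rw [this]
    simp only [fuv, duv]
    omega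
  have u : fuv n k (up n 1 a) ≤ duv k (n - a - 1) := by
    unfold up
    split_ifs with hs
    · exact uv_r (by omega)
    · rw [show n - a - 1 = a + 1 - n by omega]
      exact uv_l _ _ _
  have u' : fuv n k (up n 1 a) ≤ duv k (a + 1) := by
    unfold up
    split_ifs with hs
    · exact uv_l _ _ _
    · exact uv_r (by omega)
  omega

lemma desc_vv {n k : ℕ} (h : Good n k) {a : ℕ} (ha : a < n) (hz : fvv n k a ≠ 0) :
    fvv n k (up n k a) < fvv n k a ∨ fvv n k (dn n k a) < fvv n k a ∨
      fuv n k a < fvv n k a := by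
  have hp := h.K.pos
  have hb := h.big
  have ha0 : 0 < a := by
    rcases Nat.eq_zero_or_pos a with rfl | h0
    · simp [fvv, dvv] at hz
    · exact h0
  have v1 := uv_l n k a
  have v2 := uv_r (k := k) (by omega : a + (n - a) = n)
  rcases vv_c (k := k) (by omega : a + (n - a) = n) with c | c
  · by_cases hak : k ≤ a
    · have d : fvv n k (dn n k a) ≤ dvv k (a - k) := by
        rw [dn, if_pos hak]
        exact vv_l _ _ _
      have h1 := dvv_add hp (a - k)
      rw [Nat.sub_add_cancel hak] at h1
      omega
    · have h1 := d_desc_vv h.K (by omega : a < k) ha0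
      omega
  · by_cases hak : k ≤ n - a
    · have u : fvv n k (up n k a) ≤ dvv k (n - a - k) := by
        unfold up
        split_ifs with hs
        · exact vv_r (by omega)
        · rw [show n - a - k = a + k - n by omega]
          exact vv_l _ _ _
      have h1 := dvv_add hp (n - a - k)
      rw [Nat.sub_add_cancel hak] at h1
      omega
    · have h1 := d_desc_vv h.K (by omega : n - a < k) (by omega)
      omega

lemma fuu_zero {n k : ℕ} (h : Good n k) {a : ℕ} (ha : a < n) : fuu n k a = 0 ↔ a = 0 := by
  rcases h with ⟨rfl, h⟩ | ⟨rfl, h⟩ | ⟨rfl, h⟩ <;> simp only [fuu, duu, cst] <;> omega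

lemma fvv_zero {n k : ℕ} (h : Good n k) {a : ℕ} (ha : a < n) : fvv n k a = 0 ↔ a = 0 := by
  rcases h with ⟨rfl, h⟩ | ⟨rfl, h⟩ | ⟨rfl, h⟩ <;> simp only [fvv, dvv, cst] <;>
    split_ifs <;> omega

lemma fuv_pos (n k a : ℕ) : fuv n k a ≠ 0 := by
  simp only [fuv, duv]; omega

/-- Sign of the comparison. -/
def sg (p q : ℕ) : ℤ := (if p < q then 1 else 0) - (if q < p then 1 else 0)

def s (n k c a : ℕ) : ℤ :=
  sg (fuu n k a) (fuv n k (dn n c a)) + sg (fuv n k a) (fvv n k (dn n c a))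

def S (n k c : ℕ) : ℤ := ∑ a ∈ Finset.range n, s n k c a

lemma sg_succ (p q : ℕ) : sg (p + 1) (q + 1) = sg p q := by simp [sg]

lemma left_uu {n k a : ℕ} (hk : K k) (h : a + 6 ≤ n / 2) :
    fuu (n + 2 * k) k a = fuu n k a := by
  unfold fuu
  rw [min_eq_left (mono_uu hk (by omega)), min_eq_left (mono_uu hk (by omega))]
lemma left_uv {n k a : ℕ} (hk : K k) (h : a + 6 ≤ n / 2) :
    fuv (n + 2 * k) k a = fuv n k a := by
  unfold fuv
  rw [min_eq_left (mono_uv hk (by omega)), min_eq_left (mono_uv hk (by omega))]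
lemma left_vv {n k a : ℕ} (hk : K k) (h : a + 6 ≤ n / 2) :
    fvv (n + 2 * k) k a = fvv n k a := by
  unfold fvv
  rw [min_eq_left (mono_vv hk (by omega)), min_eq_left (mono_vv hk (by omega))]

lemma symm_uu {n k a : ℕ} (h : a ≤ n) : fuu n k (n - a) = fuu n k a := by
  unfold fuu; rw [Nat.sub_sub_self h, min_comm]
lemma symm_uv {n k a : ℕ} (h : a ≤ n) : fuv n k (n - a) = fuv n k a := by
  unfold fuv; rw [Nat.sub_sub_self h, min_comm]
lemma symm_vv {n k a : ℕ} (h : a ≤ n) : fvv n k (n - a) = fvv n k a := by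
  unfold fvv; rw [Nat.sub_sub_self h, min_comm]

lemma right_uu {n k a : ℕ} (hk : K k) (h : n / 2 + 7 ≤ a) (ha : a ≤ n) :
    fuu (n + 2 * k) k (a + 2 * k) = fuu n k a := by
  rw [← symm_uu ha, ← symm_uu (by omega : a + 2 * k ≤ n + 2 * k), Nat.add_sub_add_right]
  exact left_uu hk (by omega)
lemma right_uv {n k a : ℕ} (hk : K k) (h : n / 2 + 7 ≤ a) (ha : a ≤ n) :
    fuv (n + 2 * k) k (a + 2 * k) = fuv n k a := by
  rw [← symm_uv ha, ← symm_uv (by omega : a + 2 * k ≤ n + 2 * k), Nat.add_sub_add_right]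
  exact left_uv hk (by omega)
lemma right_vv {n k a : ℕ} (hk : K k) (h : n / 2 + 7 ≤ a) (ha : a ≤ n) :
    fvv (n + 2 * k) k (a + 2 * k) = fvv n k a := by
  rw [← symm_vv ha, ← symm_vv (by omega : a + 2 * k ≤ n + 2 * k), Nat.add_sub_add_right]
  exact left_vv hk (by omega)

lemma mid_uu {n k a : ℕ} (hk : K k) (h : 6 ≤ a) (ha : a + 6 ≤ n) :
    fuu (n + 2 * k) k (a + k) = fuu n k a + 1 := by
  have : n + 2 * k - (a + k) = n - a + k := by omega
  simp only [fuu, this]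
  rw [duu_add hk h, duu_add hk (by omega)]
  omega
lemma mid_uv {n k a : ℕ} (hk : K k) (ha : a + 6 ≤ n) :
    fuv (n + 2 * k) k (a + k) = fuv n k a + 1 := by
  have : n + 2 * k - (a + k) = n - a + k := by omega
  simp only [fuv, this]
  rw [duv_add hk.pos, duv_add hk.pos]
  omega
lemma mid_vv {n k a : ℕ} (hk : K k) (ha : a + 6 ≤ n) :
    fvv (n + 2 * k) k (a + k) = fvv n k a + 1 := by
  have : n + 2 * k - (a + k) = n - a + k := by omega
  simp only [fvv, this]
  rw [dvv_add hk.pos, dvv_add hk.pos]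
  omega

lemma s_left {n k a : ℕ} (hk : K k) (hn : 40 ≤ n) (h : a + 8 ≤ n / 2) :
    s (n + 2 * k) k 1 a = s n k 1 a := by
  unfold s
  rw [left_uu hk (by omega), left_uv (a := a) hk (by omega)]
  by_cases h1 : 1 ≤ a
  · simp only [dn, if_pos h1]
    rw [left_uv (a := a - 1) hk (by omega), left_vv hk (by omega)]
  · simp only [dn, if_neg h1]
    rw [show a + (n + 2 * k) - 1 = a + n - 1 + 2 * k by omega,
      right_uv hk (by omega) (by omega), right_vv hk (by omega) (by omega)]

lemma s_right {n k a : ℕ} (hk : K k) (hn : 40 ≤ n) (h : n / 2 + 8 ≤ a) (ha : a < n) :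
    s (n + 2 * k) k 1 (a + 2 * k) = s n k 1 a := by
  unfold s
  rw [right_uu hk (by omega) (by omega), right_uv (a := a) hk (by omega) (by omega)]
  simp only [dn, if_pos (by omega : 1 ≤ a), if_pos (by omega : 1 ≤ a + 2 * k)]
  rw [show a + 2 * k - 1 = a - 1 + 2 * k by omega,
      right_uv (a := a - 1) hk (by omega) (by omega), right_vv hk (by omega) (by omega)]

lemma s_mid {n k a : ℕ} (hk : K k) (h : 7 ≤ a) (ha : a + 6 ≤ n) :
    s (n + 2 * k) k 1 (a + k) = s n k 1 a := by
  unfold s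
  rw [mid_uu hk (by omega) (by omega), mid_uv (a := a) hk (by omega)]
  simp only [dn, if_pos (by omega : 1 ≤ a), if_pos (by omega : 1 ≤ a + k)]
  rw [show a + k - 1 = a - 1 + k by omega,
      mid_uv (a := a - 1) hk (by omega), mid_vv hk (by omega), sg_succ, sg_succ]

def E (n k : ℕ) : ℤ := ∑ j ∈ Finset.range k, s (n + 2 * k) k 1 (n / 2 - 8 + j) +
  ∑ j ∈ Finset.range k, s (n + 2 * k) k 1 (n / 2 + 8 + k + j)

lemma S_step {n k : ℕ} (hk : K k) (hn : 40 ≤ n) : S (n + 2 * k) k 1 = S n k 1 + E n k := by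
  have e1 : n = (n / 2 - 8) + 16 + (n - (n / 2 + 8)) := by omega
  have e2 : n + 2 * k = (n / 2 - 8) + k + 16 + k + (n - (n / 2 + 8)) := by omega
  have A : S n k 1 = ∑ j ∈ Finset.range (n / 2 - 8), s n k 1 j +
      ∑ j ∈ Finset.range 16, s n k 1 (n / 2 - 8 + j) +
      ∑ j ∈ Finset.range (n - (n / 2 + 8)), s n k 1 (n / 2 - 8 + 16 + j) := by
    unfold S
    rw [← Finset.sum_range_add, ← Finset.sum_range_add, ← e1]
  have B : S (n + 2 * k) k 1 = ∑ j ∈ Finset.range (n / 2 - 8), s (n + 2 * k) k 1 j +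
      ∑ j ∈ Finset.range k, s (n + 2 * k) k 1 (n / 2 - 8 + j) +
      ∑ j ∈ Finset.range 16, s (n + 2 * k) k 1 (n / 2 - 8 + k + j) +
      ∑ j ∈ Finset.range k, s (n + 2 * k) k 1 (n / 2 - 8 + k + 16 + j) +
      ∑ j ∈ Finset.range (n - (n / 2 + 8)), s (n + 2 * k) k 1 (n / 2 - 8 + k + 16 + k + j) := by
    unfold S
    rw [← Finset.sum_range_add, ← Finset.sum_range_add, ← Finset.sum_range_add,
      ← Finset.sum_range_add, ← e2]
  have h1 : ∑ j ∈ Finset.range (n / 2 - 8), s (n + 2 * k) k 1 j =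
      ∑ j ∈ Finset.range (n / 2 - 8), s n k 1 j := by
    refine Finset.sum_congr rfl fun j hj => ?_
    rw [Finset.mem_range] at hj
    exact s_left hk hn (by omega)
  have h2 : ∑ j ∈ Finset.range 16, s (n + 2 * k) k 1 (n / 2 - 8 + k + j) =
      ∑ j ∈ Finset.range 16, s n k 1 (n / 2 - 8 + j) := by
    refine Finset.sum_congr rfl fun j hj => ?_
    rw [Finset.mem_range] at hj
    rw [show n / 2 - 8 + k + j = n / 2 - 8 + j + k by omega]
    exact s_mid hk (by omega) (by omega)
  have h3 : ∑ j ∈ Finset.range (n - (n / 2 + 8)),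
        s (n + 2 * k) k 1 (n / 2 - 8 + k + 16 + k + j) =
      ∑ j ∈ Finset.range (n - (n / 2 + 8)), s n k 1 (n / 2 - 8 + 16 + j) := by
    refine Finset.sum_congr rfl fun j hj => ?_
    rw [Finset.mem_range] at hj
    rw [show n / 2 - 8 + k + 16 + k + j = n / 2 - 8 + 16 + j + 2 * k by omega]
    exact s_right hk hn (by omega) (by omega)
  rw [A, B, h1, h2, h3, E, show n / 2 - 8 + k + 16 = n / 2 + 8 + k by omega]
  ring

lemma E_step {n k : ℕ} (hk : K k) (hn : 40 ≤ n) : E (n + 2 * k) k = E n k := by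
  have hk4 : k ≤ 4 := by rcases hk with rfl | rfl | rfl <;> omega
  have hd : (n + 2 * k) / 2 = n / 2 + k := by omega
  unfold E
  congr 1 <;> refine Finset.sum_congr rfl fun j hj => ?_ <;> rw [Finset.mem_range] at hj <;>
    rw [hd]
  · rw [show n / 2 + k - 8 + j = n / 2 - 8 + j + k by omega]
    exact s_mid hk (by omega) (by omega)
  · rw [show n / 2 + k + 8 + k + j = n / 2 + 8 + k + j + k by omega]
    exact s_mid hk (by omega) (by omega)

lemma base {k : ℕ} (hk : K k) :
    ∀ i ∈ Finset.range (2 * k), S (40 + i) k 1 < 0 ∧ E (40 + i) k ≤ 0 := by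
  rcases hk with rfl | rfl | rfl <;> decide +kernel

lemma S_neg {k : ℕ} (hk : K k) : ∀ n, 40 ≤ n → S n k 1 < 0 ∧ E n k ≤ 0 := by
  have hk0 : 2 ≤ k := by rcases hk with rfl | rfl | rfl <;> omega
  intro n
  induction n using Nat.strong_induction_on with
  | _ n ih =>
    intro hn
    by_cases h : n < 40 + 2 * k
    · have := base hk (n - 40) (Finset.mem_range.2 (by omega))
      rwa [show 40 + (n - 40) = n by omega] at this
    · obtain ⟨m, rfl⟩ : ∃ m, n = m + 2 * k := ⟨n - 2 * k, by omega⟩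
      have := ih m (by omega) (by omega)
      rw [S_step hk (by omega), E_step hk (by omega)]
      exact ⟨by linarith [this.1, this.2], this.2⟩

lemma small2 : ∀ n ∈ Finset.Ico 11 40, S n 2 1 ≠ 0 := by decide +kernel
lemma small3 : ∀ n ∈ Finset.Ico 11 40, S n 3 1 ≠ 0 ∨ S n 3 3 ≠ 0 := by decide +kernel
lemma small4 : ∀ n ∈ Finset.Ico 22 40, S n 4 1 ≠ 0 ∨ S n 4 4 ≠ 0 := by decide +kernel

lemma S_ne {n k : ℕ} (h : Good n k) : S n k 1 ≠ 0 ∨ S n k k ≠ 0 := by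
  by_cases hn : 40 ≤ n
  · have hk : K k := by rcases h with ⟨rfl, _⟩ | ⟨rfl, _⟩ | ⟨rfl, _⟩ <;> simp [K]
    exact Or.inl (S_neg hk n hn).1.ne
  · rcases h with ⟨rfl, h⟩ | ⟨rfl, h⟩ | ⟨rfl, h⟩
    · exact Or.inl (small2 n (Finset.mem_Ico.2 ⟨by omega, by omega⟩))
    · exact small3 n (Finset.mem_Ico.2 ⟨by omega, by omega⟩)
    · exact small4 n (Finset.mem_Ico.2 ⟨by omega, by omega⟩)

/-- Distance to the outer vertex `u_0`. -/
def Fu (n k : ℕ) : ZMod n ⊕ ZMod n → ℕ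
  | Sum.inl i => fuu n k i.val
  | Sum.inr i => fuv n k i.val

/-- Distance to the inner vertex `v_c`. -/
def Fv (n k c : ℕ) : ZMod n ⊕ ZMod n → ℕ
  | Sum.inl i => fuv n k (i - (c : ZMod n)).val
  | Sum.inr i => fvv n k (i - (c : ZMod n)).val

section graph
variable {n k : ℕ}

lemma adj_ll (i j : ZMod n) (h1 : 1 < n) : (genPetersen n k).Adj (Sum.inl i) (Sum.inl j) ↔
    j = i + 1 ∨ i = j + 1 := by
  have : Fact (1 < n) := ⟨h1⟩
  simp only [genPetersen, SimpleGraph.fromRel_adj, ne_eq, Sum.inl.injEq, and_iff_right_iff_imp]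
  rintro (h | h) rfl <;> simp at h

lemma adj_rr (i j : ZMod n) (h0 : (k : ZMod n) ≠ 0) :
    (genPetersen n k).Adj (Sum.inr i) (Sum.inr j) ↔ j = i + k ∨ i = j + k := by
  simp only [genPetersen, SimpleGraph.fromRel_adj, ne_eq, Sum.inr.injEq, and_iff_right_iff_imp]
  rintro (h | h) rfl <;> simp [h0] at h

lemma adj_lr (i j : ZMod n) : (genPetersen n k).Adj (Sum.inl i) (Sum.inr j) ↔ i = j := by
  simp [genPetersen]

lemma adj_rl (i j : ZMod n) : (genPetersen n k).Adj (Sum.inr i) (Sum.inl j) ↔ i = j := by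
  simp [genPetersen, eq_comm]

lemma Good.lt (h : Good n k) : 1 < n ∧ k < n ∧ 0 < k := by
  rcases h with ⟨rfl, h⟩ | ⟨rfl, h⟩ | ⟨rfl, h⟩ <;> omega

lemma Good.cast_ne (h : Good n k) : (k : ZMod n) ≠ 0 := by
  rw [Ne, ZMod.natCast_eq_zero_iff]
  intro hd
  have := Nat.le_of_dvd h.lt.2.2 hd
  have := h.lt
  omega

lemma dist_u (h : Good n k) (w : ZMod n ⊕ ZMod n) :
    (genPetersen n k).dist w (Sum.inl 0) = Fu n k w := by
  have : NeZero n := ⟨by have := h.lt; omega⟩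
  have hn := h.lt
  apply dist_eq_of
  · simp [Fu, fuu_zero h (by omega : 0 < n)]
  · rintro (i | i) hi
    · simp only [Fu] at hi
      rw [fuu_zero h (ZMod.val_lt i), ZMod.val_eq_zero] at hi
      rw [hi]
    · exact absurd hi (fuv_pos _ _ _)
  · rintro (i | i) (j | j) hij
    · rw [adj_ll _ _ hn.1] at hij
      rw [← Nat.cast_one] at hij
      rcases hij with rfl | rfl <;> simp only [Fu] <;> rw [val_add_nat _ _ hn.1]
      · exact (lip_uu h (ZMod.val_lt i)).1
      · exact (lip_uu h (ZMod.val_lt j)).2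
    · rw [adj_lr] at hij
      subst hij
      exact (lip_u h _).1
    · rw [adj_rl] at hij
      subst hij
      exact (lip_u h _).2
    · rw [adj_rr _ _ h.cast_ne] at hij
      rcases hij with rfl | rfl <;> simp only [Fu] <;> rw [val_add_nat _ _ hn.2.1]
      · exact (lip_uvk h (ZMod.val_lt i)).1
      · exact (lip_uvk h (ZMod.val_lt j)).2
  · rintro (i | i) hi
    · rcases desc_uu h (ZMod.val_lt i) hi with hd | hd | hd
      · rw [← val_add_nat _ _ hn.1] at hd
        exact ⟨Sum.inl (i + (1 : ℕ)), by rw [adj_ll _ _ hn.1]; simp, hd⟩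
      · rw [← val_sub_nat _ _ hn.1] at hd
        exact ⟨Sum.inl (i - (1 : ℕ)), by rw [adj_ll _ _ hn.1]; simp, hd⟩
      · exact ⟨Sum.inr i, by rw [adj_lr], hd⟩
    · rcases desc_vu h (ZMod.val_lt i) with hd | hd | hd
      · rw [← val_add_nat _ _ hn.2.1] at hd
        exact ⟨Sum.inr (i + k), by rw [adj_rr _ _ h.cast_ne]; simp, hd⟩
      · rw [← val_sub_nat _ _ hn.2.1] at hd
        exact ⟨Sum.inr (i - k), by rw [adj_rr _ _ h.cast_ne]; simp, hd⟩
      · exact ⟨Sum.inl i, by rw [adj_rl], hd⟩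

lemma dist_v (h : Good n k) (c : ℕ) (w : ZMod n ⊕ ZMod n) :
    (genPetersen n k).dist w (Sum.inr (c : ZMod n)) = Fv n k c w := by
  have : NeZero n := ⟨by have := h.lt; omega⟩
  have hn := h.lt
  apply dist_eq_of
  · simp [Fv, fvv_zero h (by omega : 0 < n)]
  · rintro (i | i) hi
    · exact absurd hi (fuv_pos _ _ _)
    · simp only [Fv] at hi
      rw [fvv_zero h (ZMod.val_lt _), ZMod.val_eq_zero, sub_eq_zero] at hi
      rw [hi]
  · rintro (i | i) (j | j) hij
    · rw [adj_ll _ _ hn.1] at hij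
      rw [← Nat.cast_one] at hij
      rcases hij with rfl | rfl <;> simp only [Fv] <;>
        rw [add_sub_right_comm, val_add_nat _ _ hn.1]
      · exact (lip_uv h (ZMod.val_lt _)).1
      · exact (lip_uv h (ZMod.val_lt _)).2
    · rw [adj_lr] at hij
      subst hij
      exact (lip_v h _).2
    · rw [adj_rl] at hij
      subst hij
      exact (lip_v h _).1
    · rw [adj_rr _ _ h.cast_ne] at hij
      rcases hij with rfl | rfl <;> simp only [Fv] <;>
        rw [add_sub_right_comm, val_add_nat _ _ hn.2.1]
      · exact (lip_vv h (ZMod.val_lt _)).1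
      · exact (lip_vv h (ZMod.val_lt _)).2
  · rintro (i | i) hi
    · rcases desc_uv h (ZMod.val_lt (i - (c : ZMod n))) with hd | hd | hd
      · rw [← val_add_nat _ _ hn.1, ← add_sub_right_comm] at hd
        exact ⟨Sum.inl (i + (1 : ℕ)), by rw [adj_ll _ _ hn.1]; simp, hd⟩
      · rw [← val_sub_nat _ _ hn.1, sub_right_comm] at hd
        exact ⟨Sum.inl (i - (1 : ℕ)), by rw [adj_ll _ _ hn.1]; simp, hd⟩
      · exact ⟨Sum.inr i, by rw [adj_lr], hd⟩
    · rcases desc_vv h (ZMod.val_lt (i - (c : ZMod n))) hi with hd | hd | hd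
      · rw [← val_add_nat _ _ hn.2.1, ← add_sub_right_comm] at hd
        exact ⟨Sum.inr (i + k), by rw [adj_rr _ _ h.cast_ne]; simp, hd⟩
      · rw [← val_sub_nat _ _ hn.2.1, sub_right_comm] at hd
        exact ⟨Sum.inr (i - k), by rw [adj_rr _ _ h.cast_ne]; simp, hd⟩
      · exact ⟨Sum.inl i, by rw [adj_rl], hd⟩

lemma ncard_closer {V : Type*} [Fintype V] (G : SimpleGraph V) (x y : V) :
    ((closerSet G x y).ncard : ℤ) = ∑ w : V, if G.dist w x < G.dist w y then 1 else 0 := by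
  classical
  rw [Finset.sum_boole, ← Set.ncard_coe_finset]
  simp [closerSet]

lemma sum_zmod [NeZero n] (f : ℕ → ℤ) : ∑ i : ZMod n, f i.val = ∑ a ∈ Finset.range n, f a := by
  obtain ⟨m, rfl⟩ : ∃ m, n = m + 1 := ⟨n - 1, by have := NeZero.ne n; omega⟩
  exact Fin.sum_univ_eq_sum_range f (m + 1)

lemma S_eq_zero (h : Good n k) (hb : IsLDistBalanced (genPetersen n k) 2) (c : ℕ)
    (hc : c = 1 ∨ c = k) : S n k c = 0 := by
  have : NeZero n := ⟨by have := h.lt; omega⟩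
  have hn := h.lt
  have hcn : c < n := by rcases hc with rfl | rfl <;> omega
  have hd : (genPetersen n k).dist (Sum.inl 0) (Sum.inr (c : ZMod n)) = 2 := by
    rw [dist_v h]
    simp only [Fv]
    rw [val_sub_nat _ _ hcn, ZMod.val_zero]
    rcases hc with rfl | rfl
    · rcases h with ⟨rfl, h⟩ | ⟨rfl, h⟩ | ⟨rfl, h⟩ <;> simp [dn, fuv, duv, cst] <;> omega
    · rcases h with ⟨rfl, h⟩ | ⟨rfl, h⟩ | ⟨rfl, h⟩ <;> simp [dn, fuv, duv, cst] <;> omega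
  have hw := hb _ _ hd
  have hz : ((closerSet (genPetersen n k) (Sum.inl 0) (Sum.inr (c : ZMod n))).ncard : ℤ) -
      ((closerSet (genPetersen n k) (Sum.inr (c : ZMod n)) (Sum.inl 0)).ncard : ℤ) = 0 := by
    rw [hw, sub_self]
  rw [ncard_closer, ncard_closer, ← Finset.sum_sub_distrib, Fintype.sum_sum_type,
    ← Finset.sum_add_distrib] at hz
  simp only [dist_u h, dist_v h, Fu, Fv, val_sub_nat _ _ hcn] at hz
  rw [← hz, S, ← sum_zmod]
  rfl

end graph

end GPAux

theorem stmt_8 (n k : ℕ)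
    (h : (k = 2 ∧ 10 < n) ∨ (k = 3 ∧ 10 < n) ∨ (k = 4 ∧ 21 < n))
    (hkn : 2 * k < n) :
    ¬ IsLDistBalanced (genPetersen n k) 2 := by
  intro hb
  rcases GPAux.S_ne h with h1 | h1
  · exact h1 (GPAux.S_eq_zero h hb 1 (Or.inl rfl))
  · exact h1 (GPAux.S_eq_zero h hb k (Or.inr rfl))
end

section
/- The generalized Petersen graphs GP(10,2), GP(10,3), and GP(21,4) are 2-distance-balanced. -/
namespace GPAux

/-- Candidate distance function, read off from three tables. -/
def tdist (n : ℕ) (A B C : List ℕ) : ZMod n ⊕ ZMod n → ZMod n ⊕ ZMod n → ℕ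
  | Sum.inl i, Sum.inl j => A.getD (j - i).val 0
  | Sum.inl i, Sum.inr j => B.getD (j - i).val 0
  | Sum.inr i, Sum.inl j => B.getD (j - i).val 0
  | Sum.inr i, Sum.inr j => C.getD (j - i).val 0

/-- Neighbours of a vertex. -/
def nb (n k : ℕ) : ZMod n ⊕ ZMod n → List (ZMod n ⊕ ZMod n)
  | Sum.inl i => [Sum.inl (i + 1), Sum.inl (i - 1), Sum.inr i]
  | Sum.inr i => [Sum.inr (i + (k : ZMod n)), Sum.inr (i - (k : ZMod n)), Sum.inl i]

theorem mem_nb_of_adj {n k : ℕ} {x y : ZMod n ⊕ ZMod n} (h : (genPetersen n k).Adj x y) :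
    y ∈ nb n k x := by
  unfold genPetersen at h
  rw [SimpleGraph.fromRel_adj] at h
  obtain ⟨-, h⟩ := h
  rcases x with i | i <;> rcases y with j | j <;> simp [nb] at h ⊢ <;> grind

theorem adj_of_mem_nb {n k : ℕ} {x y : ZMod n ⊕ ZMod n} (hne : x ≠ y) (h : y ∈ nb n k x) :
    (genPetersen n k).Adj x y := by
  unfold genPetersen
  rw [SimpleGraph.fromRel_adj]
  refine ⟨hne, ?_⟩
  rcases x with i | i <;> rcases y with j | j <;> simp [nb] at h ⊢ <;> grind

theorem dist_eq {n k : ℕ} (f : ZMod n ⊕ ZMod n → ZMod n ⊕ ZMod n → ℕ)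
    (h0 : ∀ x, f x x = 0)
    (h1 : ∀ x y, ∀ z ∈ nb n k y, f x z ≤ f x y + 1)
    (h2 : ∀ x y, x = y ∨ ∃ z ∈ nb n k y, f x z + 1 = f x y)
    (x y : ZMod n ⊕ ZMod n) : (genPetersen n k).dist x y = f x y := by
  have low : ∀ a b (p : (genPetersen n k).Walk a b), f x b ≤ f x a + p.length := by
    intro a b p
    induction p with
    | nil => simp
    | cons h p ih =>
      have := h1 x _ _ (mem_nb_of_adj h)
      simp only [SimpleGraph.Walk.length_cons]
      omega
  have up : ∀ m y, f x y = m → ∃ p : (genPetersen n k).Walk x y, p.length = m := by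
    intro m
    induction m with
    | zero =>
      intro y hy
      rcases h2 x y with rfl | ⟨z, -, hz⟩
      · exact ⟨SimpleGraph.Walk.nil, rfl⟩
      · omega
    | succ m ih =>
      intro y hy
      rcases h2 x y with rfl | ⟨z, hz, hz'⟩
      · rw [h0] at hy; omega
      · obtain ⟨p, hp⟩ := ih z (by omega)
        have hne : y ≠ z := by rintro rfl; omega
        exact ⟨p.concat (adj_of_mem_nb hne hz).symm, by simp [hp]⟩
  obtain ⟨p, hp⟩ := up _ y rfl
  apply le_antisymm
  · rw [← hp]; exact SimpleGraph.dist_le p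
  · obtain ⟨q, hq⟩ := p.reachable.exists_walk_length_eq_dist
    have := low x y q
    rw [h0] at this
    omega

theorem balanced {n k : ℕ} [NeZero n] (f : ZMod n ⊕ ZMod n → ZMod n ⊕ ZMod n → ℕ)
    (h0 : ∀ x, f x x = 0)
    (h1 : ∀ x y, ∀ z ∈ nb n k y, f x z ≤ f x y + 1)
    (h2 : ∀ x y, x = y ∨ ∃ z ∈ nb n k y, f x z + 1 = f x y)
    (h3 : ∀ x y, f x y = 2 → (Finset.univ.filter (fun w => f w x < f w y)).card =
      (Finset.univ.filter (fun w => f w y < f w x)).card) :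
    IsLDistBalanced (genPetersen n k) 2 := by
  intro x y hxy
  have key : ∀ a b, (closerSet (genPetersen n k) a b).ncard =
      (Finset.univ.filter (fun w => f w a < f w b)).card := by
    intro a b
    rw [← Set.ncard_coe_finset]
    congr 1
    ext w
    simp [closerSet, dist_eq f h0 h1 h2]
  rw [dist_eq f h0 h1 h2] at hxy
  rw [key, key]
  exact h3 x y hxy

/-- Rotation of the vertex set. -/
def rot {n : ℕ} (c : ZMod n) : (ZMod n ⊕ ZMod n) ≃ (ZMod n ⊕ ZMod n) :=
  Equiv.sumCongr (Equiv.addRight c) (Equiv.addRight c)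

theorem tdist_rot {n : ℕ} (A B C : List ℕ) (c : ZMod n) (x y : ZMod n ⊕ ZMod n) :
    tdist n A B C (rot c x) (rot c y) = tdist n A B C x y := by
  rcases x with i | i <;> rcases y with j | j <;> simp [tdist, rot]

theorem mem_nb_rot {n k : ℕ} (c : ZMod n) {y z : ZMod n ⊕ ZMod n} (h : z ∈ nb n k y) :
    rot c z ∈ nb n k (rot c y) := by
  rcases y with i | i <;> rcases z with j | j <;> simp [nb, rot] at h ⊢ <;> grind

theorem exists_rot {n : ℕ} (x : ZMod n ⊕ ZMod n) :
    ∃ c, ∃ x₀ ∈ [Sum.inl 0, Sum.inr 0], x = rot (n := n) c x₀ := by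
  rcases x with i | i
  · exact ⟨i, Sum.inl 0, by simp, by simp [rot]⟩
  · exact ⟨i, Sum.inr 0, by simp, by simp [rot]⟩

/-- It suffices to check the conditions for the base points `u_0` and `v_0`. -/
theorem balanced_of_base {n : ℕ} (k : ℕ) [NeZero n] (A B C : List ℕ)
    (h0 : ∀ x ∈ [Sum.inl 0, Sum.inr 0], tdist n A B C x x = 0)
    (h1 : ∀ x ∈ [Sum.inl 0, Sum.inr 0], ∀ y, ∀ z ∈ nb n k y,
      tdist n A B C x z ≤ tdist n A B C x y + 1)
    (h2 : ∀ x ∈ [Sum.inl 0, Sum.inr 0], ∀ y, x = y ∨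
      ∃ z ∈ nb n k y, tdist n A B C x z + 1 = tdist n A B C x y)
    (h3 : ∀ x ∈ [Sum.inl 0, Sum.inr 0], ∀ y, tdist n A B C x y = 2 →
      (Finset.univ.filter (fun w => tdist n A B C w x < tdist n A B C w y)).card =
      (Finset.univ.filter (fun w => tdist n A B C w y < tdist n A B C w x)).card) :
    IsLDistBalanced (genPetersen n k) 2 := by
  apply balanced (tdist n A B C)
  · intro x
    obtain ⟨c, x, hx, rfl⟩ := exists_rot x
    rw [tdist_rot]
    exact h0 x hx
  · intro x y z hz
    obtain ⟨c, x, hx, rfl⟩ := exists_rot x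
    have hz' := mem_nb_rot (-c) hz
    have e : ∀ w, tdist n A B C (rot c x) w = tdist n A B C x (rot (-c) w) := by
      intro w
      rw [← tdist_rot A B C (-c)]
      congr 1
      rcases x with i | i <;> simp [rot]
    rw [e, e]
    exact h1 x hx _ _ hz'
  · intro x y
    obtain ⟨c, x, hx, rfl⟩ := exists_rot x
    obtain ⟨y, rfl⟩ := (rot c).surjective y
    rcases h2 x hx y with rfl | ⟨z, hz, hz'⟩
    · exact Or.inl rfl
    · exact Or.inr ⟨rot c z, mem_nb_rot c hz, by rw [tdist_rot, tdist_rot, hz']⟩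
  · intro x y hxy
    obtain ⟨c, x, hx, rfl⟩ := exists_rot x
    obtain ⟨y, rfl⟩ := (rot c).surjective y
    rw [tdist_rot] at hxy
    have key : ∀ a b,
        (Finset.univ.filter
          (fun w => tdist n A B C w (rot c a) < tdist n A B C w (rot c b))).card =
        (Finset.univ.filter (fun w => tdist n A B C w a < tdist n A B C w b)).card := by
      intro a b
      symm
      apply Finset.card_equiv (rot c)
      intro w
      simp [tdist_rot]
    rw [key, key]
    exact h3 x hx y hxy

end GPAux

open GPAux in
theorem stmt_9 :
    IsLDistBalanced (genPetersen 10 2) 2 ∧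
    IsLDistBalanced (genPetersen 10 3) 2 ∧
    IsLDistBalanced (genPetersen 21 4) 2 := by
  refine ⟨?_, ?_, ?_⟩
  · apply balanced_of_base _ [0, 1, 2, 3, 4, 5, 4, 3, 2, 1] [1, 2, 2, 3, 3, 4, 3, 3, 2, 2]
      [0, 3, 1, 4, 2, 5, 2, 4, 1, 3] <;> decide +kernel
  · apply balanced_of_base _ [0, 1, 2, 3, 4, 5, 4, 3, 2, 1] [1, 2, 3, 2, 3, 4, 3, 2, 3, 2]
      [0, 3, 4, 1, 2, 5, 2, 1, 4, 3] <;> decide +kernel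
  · apply balanced_of_base _
      [0, 1, 2, 3, 3, 4, 5, 5, 4, 5, 6, 6, 5, 4, 5, 5, 4, 3, 3, 2, 1]
      [1, 2, 3, 3, 2, 3, 4, 4, 3, 4, 5, 5, 4, 3, 4, 4, 3, 2, 3, 3, 2]
      [0, 3, 4, 4, 1, 4, 5, 5, 2, 3, 6, 6, 3, 2, 5, 5, 4, 1, 4, 4, 3] <;> decide +kernel
end
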